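/- For every computably enumerable set A that is not K-trivial, there exists a computably enumerable set B and a computably enumerable prefix-free machine M such that B is Turing equivalent to the halting problem ∅′ and K_M(B↾n) ≤ K(A↾n) for all n. -/

import Mathlib

open Part Filter

open scoped Classical

namespace KPaper

/-- Binary strings. -/
abbrev Str := List Bool

/-! ### Oracle (Turing) reducibility -/

/-- The functions `ℕ →. ℕ` that are partial recursive relative to an oracle `O : ℕ →. ℕ`.
This mirrors Mathlib's `Nat.Partrec`, with an extra base case for the oracle. -/
inductive RecursiveIn (O : ℕ →. ℕ) : (ℕ →. ℕ) → Prop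
  | oracle : RecursiveIn O O
  | zero : RecursiveIn O (pure 0)
  | succ : RecursiveIn O ↑Nat.succ
  | left : RecursiveIn O ↑fun n : ℕ => n.unpair.1
  | right : RecursiveIn O ↑fun n : ℕ => n.unpair.2
  | pair {f g} : RecursiveIn O f → RecursiveIn O g →
      RecursiveIn O fun n => Nat.pair <$> f n <*> g n
  | comp {f g} : RecursiveIn O f → RecursiveIn O g → RecursiveIn O fun n => g n >>= f
  | prec {f g} : RecursiveIn O f → RecursiveIn O g → RecursiveIn O (Nat.unpaired fun a n =>
      n.rec (f a) fun y IH => do let i ← IH; g (Nat.pair a (Nat.pair y i)))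
  | rfind {f} : RecursiveIn O f →
      RecursiveIn O fun a => Nat.rfind fun n => (fun m => m = 0) <$> f (Nat.pair a n)

/-- The characteristic (partial) function of a set of naturals, used as a Turing oracle. -/
noncomputable def chi (A : Set ℕ) : ℕ →. ℕ := fun n => Part.some (if n ∈ A then 1 else 0)

/-- The characteristic function of an infinite binary sequence, used as a Turing oracle. -/
def chiSeq (X : ℕ → Bool) : ℕ →. ℕ := fun n => Part.some (cond (X n) 1 0)

/-- `A` is Turing reducible to `B`. -/
noncomputable def TuringLeSet (A B : Set ℕ) : Prop := RecursiveIn (chi B) (chi A)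

/-- `A` is Turing equivalent to `B`. -/
noncomputable def TuringEquivSet (A B : Set ℕ) : Prop := TuringLeSet A B ∧ TuringLeSet B A

/-- Turing equivalence between a set and an infinite binary sequence. -/
noncomputable def TuringEquivSetSeq (A : Set ℕ) (X : ℕ → Bool) : Prop :=
  RecursiveIn (chiSeq X) (chi A) ∧ RecursiveIn (chi A) (chiSeq X)

/-- The halting problem `∅'`. -/
def haltingSet : Set ℕ := {n | ((Denumerable.ofNat Nat.Partrec.Code n).eval n).Dom}

/-- A set of naturals is computably enumerable iff it is the domain of a
partial computable function. -/
def CESet (A : Set ℕ) : Prop := ∃ f : ℕ →. ℕ, Nat.Partrec f ∧ ∀ n, n ∈ A ↔ (f n).Dom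

/-! ### Machines and Kolmogorov complexity -/

/-- A (plain) machine is a partial computable map from binary strings to binary strings. -/
def PlainMachine (M : Str →. Str) : Prop := Partrec M

/-- A prefix-free machine: a partial computable map on binary strings whose
domain is an antichain under the prefix relation. -/
def PFMachine (M : Str →. Str) : Prop :=
  Partrec M ∧ ∀ ρ₁ ρ₂ : Str, (M ρ₁).Dom → (M ρ₂).Dom → ρ₁ <+: ρ₂ → ρ₁ = ρ₂

/-- The Kolmogorov complexity of a string `σ` with respect to a machine `M`:
the least length of an `M`-description of `σ` (`⊤` if there is none). -/
noncomputable def KC (M : Str →. Str) (σ : Str) : ℕ∞ :=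
  ⨅ ρ : {ρ : Str // σ ∈ M ρ}, ((ρ : Str).length : ℕ∞)

/-- An optimal prefix-free machine: a prefix-free machine whose associated complexity
is minimal, up to an additive constant, among all prefix-free machines. -/
def OptimalPF (U : Str →. Str) : Prop :=
  PFMachine U ∧ ∀ M : Str →. Str, PFMachine M → ∃ c : ℕ, ∀ σ : Str, KC U σ ≤ KC M σ + c

/-- An optimal plain machine. -/
def OptimalPlain (V : Str →. Str) : Prop :=
  PlainMachine V ∧ ∀ M : Str →. Str, PlainMachine M → ∃ c : ℕ, ∀ σ : Str, KC V σ ≤ KC M σ + c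

/-! ### Initial segments -/

/-- The first `n` bits of the characteristic sequence of a set of naturals. -/
noncomputable def restrSet (A : Set ℕ) (n : ℕ) : Str :=
  (List.range n).map fun i => decide (i ∈ A)

/-- The first `n` bits of an infinite binary sequence. -/
def restrSeq (X : ℕ → Bool) (n : ℕ) : Str := (List.range n).map X

/-- The string `0^n`; `K(n)` is identified with `K(0^n)`. -/
def zeroStr (n : ℕ) : Str := List.replicate n false

/-! ### `≤_K`, `<_K`, `K`-triviality (and the `≤_C` analogues) -/

def KLeSet (U : Str →. Str) (A B : Set ℕ) : Prop :=
  ∃ c : ℕ, ∀ n, KC U (restrSet A n) ≤ KC U (restrSet B n) + c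

def KLtSet (U : Str →. Str) (A B : Set ℕ) : Prop := KLeSet U A B ∧ ¬ KLeSet U B A

def KTrivialSet (U : Str →. Str) (A : Set ℕ) : Prop :=
  ∃ c : ℕ, ∀ n, KC U (restrSet A n) ≤ KC U (zeroStr n) + c

def KLeSeq (U : Str →. Str) (X Y : ℕ → Bool) : Prop :=
  ∃ c : ℕ, ∀ n, KC U (restrSeq X n) ≤ KC U (restrSeq Y n) + c

def KLtSeq (U : Str →. Str) (X Y : ℕ → Bool) : Prop := KLeSeq U X Y ∧ ¬ KLeSeq U Y X

def KTrivialSeq (U : Str →. Str) (X : ℕ → Bool) : Prop :=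
  ∃ c : ℕ, ∀ n, KC U (restrSeq X n) ≤ KC U (zeroStr n) + c

/-! ### Computably enumerable reals -/

/-- The real number in `[0,1]` whose binary expansion is the sequence `X`. -/
noncomputable def realOfSeq (X : ℕ → Bool) : ℝ := ∑' i : ℕ, cond (X i) ((2 : ℝ) ^ (i + 1))⁻¹ 0

/-- `X` (identified with the real it is the binary expansion of) is a computably
enumerable real: it is the limit of a nondecreasing computable sequence of
(dyadic) rationals. -/
def CEReal (X : ℕ → Bool) : Prop :=
  ∃ f : ℕ → ℤ, Computable f ∧
    (∀ s, (f s : ℝ) / 2 ^ s ≤ (f (s + 1) : ℝ) / 2 ^ (s + 1)) ∧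
    Tendsto (fun s => (f s : ℝ) / 2 ^ s) atTop (nhds (realOfSeq X))

/-- The characteristic sequence of a set of naturals. -/
noncomputable def seqOfSet (A : Set ℕ) : ℕ → Bool := fun i => decide (i ∈ A)

/-! ### Solovay reducibility -/

/-- Solovay reducibility on c.e. reals: `X ≤_S Y` iff there are nondecreasing computable
rational approximations to `X` and `Y` and a constant `c` such that at each stage the
distance to `X` is bounded by `c` times the distance to `Y`. -/
def SolovayLe (X Y : ℕ → Bool) : Prop :=
  ∃ (c : ℕ) (f g : ℕ → ℤ), Computable f ∧ Computable g ∧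
    (∀ s, (f s : ℝ) / 2 ^ s ≤ (f (s + 1) : ℝ) / 2 ^ (s + 1)) ∧
    (∀ s, (g s : ℝ) / 2 ^ s ≤ (g (s + 1) : ℝ) / 2 ^ (s + 1)) ∧
    Tendsto (fun s => (f s : ℝ) / 2 ^ s) atTop (nhds (realOfSeq X)) ∧
    Tendsto (fun s => (g s : ℝ) / 2 ^ s) atTop (nhds (realOfSeq Y)) ∧
    ∀ s, realOfSeq X - (f s : ℝ) / 2 ^ s ≤ (c : ℝ) * (realOfSeq Y - (g s : ℝ) / 2 ^ s)


theorem pre_total {a b c : Str} (h1 : a <+: c) (h2 : b <+: c) : a <+: b ∨ b <+: a := by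
  rcases le_total a.length b.length with h | h
  · exact Or.inl (List.prefix_of_prefix_length_le h1 h2 h)
  · exact Or.inr (List.prefix_of_prefix_length_le h2 h1 h)

/-! ### The abstract combinatorial system -/

structure Sys0 where
  al : ℕ → ℕ → Bool
  born : ℕ → ℕ → Bool
  nn : ℕ → ℕ
  wt : ℕ → ℝ
  ch : ℕ → ℕ → Bool
  al_lt : ∀ p s, al p s = true → p < s
  al_nn : ∀ p s, al p s = true → nn p < s
  al_born : ∀ p s, al p s = true → born p s = true
  born_lt : ∀ p s, born p s = true → p < s
  born_mono : ∀ p s t, s ≤ t → born p s = true → born p t = true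
  al_step : ∀ p s, al p s = true → ch s (nn p) = false → al p (s+1) = true
  al_dead : ∀ p r s t, al p r = true → r ≤ s → ch s (nn p) = true → s < t → al p t = false
  ch_mono : ∀ s d d', d ≤ d' → ch s d = true → ch s d' = true
  ch_fin : ∀ d, ∃ s0, ∀ s, s0 ≤ s → ch s d = false
  wt_nonneg : ∀ p, 0 ≤ wt p
  kraft : ∀ F : Finset ℕ, (∀ p ∈ F, ∃ s, born p s = true) → ∑ p ∈ F, wt p ≤ 1

namespace Sys0
variable (Y : Sys0)

noncomputable def Om (s : ℕ) : ℝ := ∑ p ∈ (Finset.range s).filter (fun p => Y.born p s = true), Y.wt p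

noncomputable def aset (s d : ℕ) : Finset ℕ :=
  (Finset.range s).filter (fun p => Y.al p s = true ∧ d ≤ Y.nn p)

noncomputable def W (s d : ℕ) : ℝ := ∑ p ∈ Y.aset s d, Y.wt p

noncomputable def wts (F : Finset ℕ) : ℝ := ∑ p ∈ F, Y.wt p

theorem mem_aset {s d p : ℕ} : p ∈ Y.aset s d ↔ Y.al p s = true ∧ d ≤ Y.nn p := by
  unfold aset
  rw [Finset.mem_filter, Finset.mem_range]
  exact ⟨fun h => h.2, fun h => ⟨Y.al_lt _ _ h.1, h⟩⟩

theorem wts_nonneg (F : Finset ℕ) : 0 ≤ Y.wts F := Finset.sum_nonneg fun p _ => Y.wt_nonneg p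

theorem wts_mono {F G : Finset ℕ} (h : F ⊆ G) : Y.wts F ≤ Y.wts G :=
  Finset.sum_le_sum_of_subset_of_nonneg h fun p _ _ => Y.wt_nonneg p

theorem W_nonneg (s d : ℕ) : 0 ≤ Y.W s d := Y.wts_nonneg _

theorem Om_mono {s t : ℕ} (h : s ≤ t) : Y.Om s ≤ Y.Om t := by
  apply Finset.sum_le_sum_of_subset_of_nonneg
  · intro p hp
    rw [Finset.mem_filter, Finset.mem_range] at *
    exact ⟨by omega, Y.born_mono _ _ _ h hp.2⟩
  · intro p _ _; exact Y.wt_nonneg p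

theorem Om_le_one (s : ℕ) : Y.Om s ≤ 1 := by
  apply Y.kraft
  intro p hp
  exact ⟨s, (Finset.mem_filter.1 hp).2⟩

theorem Om_nonneg (s : ℕ) : 0 ≤ Y.Om s := Y.wts_nonneg _

theorem W_top (s : ℕ) : Y.W s s = 0 := by
  apply Finset.sum_eq_zero
  intro p hp
  rw [mem_aset] at hp
  have := Y.al_nn _ _ hp.1
  omega

theorem wts_ever {F : Finset ℕ} (h : ∀ p ∈ F, ∃ t, Y.al p t = true) : Y.wts F ≤ 1 := by
  apply Y.kraft
  intro p hp
  obtain ⟨t, ht⟩ := h p hp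
  exact ⟨t, Y.al_born _ _ ht⟩

theorem not_ch_of_al {p r s t : ℕ} (h1 : Y.al p r = true) (hrs : r ≤ s) (hst : s < t)
    (h2 : Y.al p t = true) : Y.ch s (Y.nn p) = false := by
  by_contra h
  rw [Bool.not_eq_false] at h
  have := Y.al_dead p r s t h1 hrs h hst
  rw [this] at h2
  exact absurd h2 (by decide)

theorem al_convex {p r t : ℕ} (h1 : Y.al p r = true) (h2 : Y.al p t = true) :
    ∀ s, r ≤ s → s ≤ t → Y.al p s = true := by
  intro s hrs
  induction s, hrs using Nat.le_induction with
  | base => intro _; exact h1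
  | succ n hn ih =>
    intro hst
    exact Y.al_step _ _ (ih (by omega)) (Y.not_ch_of_al h1 hn (by omega) h2)

end Sys0

structure Sys extends Sys0 where
  nl : ℕ → ℕ → ℕ → ℕ → ℕ → ℕ
  nl_ge : ∀ s e g d h, g ≤ h → g ≤ nl s e g d h
  nl_le : ∀ s e g d h, nl s e g d h ≤ h
  nl_spec : ∀ s e g d h, g < nl s e g d h → e ≤ s → 
    toSys0.W (s+1) d ≤ (1/8)^(nl s e g d h) * (toSys0.Om (s+1) - toSys0.Om e)
  nl_max : ∀ s e g d h k, nl s e g d h < k → k ≤ h → e ≤ s → 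
    (1/8)^k * (toSys0.Om (s+1) - toSys0.Om e) < toSys0.W (s+1) d

namespace Sys
variable (Y : Sys)

def h1 (s d h : ℕ) : ℕ := if Y.ch s d then d+1 else h

def proc (s : ℕ) : ℕ → ℕ → List (ℕ × ℕ) → List (ℕ × ℕ)
  | _, _, [] => [(s+1, s+2)]
  | e, g, (d, h) :: R =>
    if Y.ch s d = true ∨ Y.nl s e g d (Y.h1 s d h) < Y.h1 s d h then
      [(d, Y.nl s e g d (Y.h1 s d h)), (s+1, s+2)]
    else (d, h) :: proc s d h R

def st : ℕ → List (ℕ × ℕ)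
  | 0 => [(0, 1)]
  | s+1 => Y.proc s 0 0 (st s)

def trg (s : ℕ) : ℕ → ℕ → List (ℕ × ℕ) → Option ℕ
  | _, _, [] => Option.none
  | e, g, (d, h) :: R =>
    if Y.nl s e g d (Y.h1 s d h) < Y.h1 s d h then Option.some d
    else if Y.ch s d = true then Option.none
    else trg s d h R

def ev (k s : ℕ) : ℕ → ℕ → List (ℕ × ℕ) → Option (ℕ × ℕ)
  | _, _, [] => Option.none
  | e, g, (d, h) :: R =>
    if Y.nl s e g d (Y.h1 s d h) ≤ k ∧ k < Y.h1 s d h then Option.some (e, d)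
    else if Y.ch s d = true ∨ Y.nl s e g d (Y.h1 s d h) < Y.h1 s d h then Option.none
    else ev k s d h R

/-- structural invariant -/
def Srt (s : ℕ) : ℕ → ℕ → List (ℕ × ℕ) → Prop
  | _, _, [] => True
  | e, g, (d, h) :: R => e ≤ d ∧ d ≤ s ∧ g ≤ h ∧ h ≤ d+1 ∧
      (g < h → Y.W s d ≤ (1/8)^h * (Y.Om s - Y.Om e)) ∧ Srt s d h R

theorem Srt_single (s e g : ℕ) (he : e ≤ s) (hg : g ≤ s+1) : Y.Srt s e g [(s, s+1)] := by
  refine ⟨he, le_rfl, by omega, le_rfl, fun _ => ?_, trivial⟩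
  rw [Y.W_top]
  have := Y.Om_mono he
  apply mul_nonneg (by positivity) (by linarith)

theorem Srt_proc (s : ℕ) : ∀ L e g, e ≤ s → g ≤ e+1 → Y.Srt s e g L →
    Y.Srt (s+1) e g (Y.proc s e g L) := by
  intro L
  induction L with
  | nil => intro e g he hg _; exact Y.Srt_single (s+1) e g (by omega) (by omega)
  | cons a R ih =>
    obtain ⟨d, h⟩ := a
    intro e g he hg ⟨h1, h2, h3, h4, h5, h6⟩
    have hh : g ≤ Y.h1 s d h ∧ Y.h1 s d h ≤ d + 1 := by unfold Sys.h1; split_ifs <;> omega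
    have n1 := Y.nl_ge s e g d _ hh.1
    have n2 := Y.nl_le s e g d (Y.h1 s d h)
    unfold proc
    split_ifs with hc
    · refine ⟨h1, by omega, n1, by omega, fun hlt => Y.nl_spec _ _ _ _ _ hlt he, ?_⟩
      exact Y.Srt_single (s+1) _ _ (by omega) (by omega)
    · push Not at hc
      have e1 : Y.h1 s d h = h := by unfold Sys.h1; simp [hc.1]
      rw [e1] at hc n2
      have e2 : Y.nl s e g d h = h := le_antisymm n2 hc.2
      refine ⟨h1, by omega, h3, h4, fun hlt => ?_, ih d h h2 (by omega) h6⟩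
      have := Y.nl_spec s e g d h (by omega) he
      rwa [e2] at this

theorem Srt_st (s : ℕ) : Y.Srt s 0 0 (Y.st s) := by
  induction s with
  | zero => exact Y.Srt_single 0 0 0 le_rfl (by omega)
  | succ s ih => exact Y.Srt_proc s _ 0 0 (by omega) (by omega) ih

/-! position of `k` -/
def pos (k : ℕ) : List (ℕ × ℕ) → ℕ
  | [] => 0
  | (d, h) :: R => if k < h then d+1 else pos k R

theorem pos_append (k : ℕ) (P R : List (ℕ × ℕ)) (hP : ∀ a ∈ P, a.2 ≤ k) :
    pos k (P ++ R) = pos k R := by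
  induction P with
  | nil => rfl
  | cons a P ih =>
    obtain ⟨d, h⟩ := a
    have h1 := hP (d, h) (by simp)
    simp only [List.cons_append, pos]
    rw [if_neg (by simpa using h1), ih (fun a ha => hP a (by simp [ha]))]

theorem pos_W {k s d : ℕ} : ∀ L e g, g ≤ k → Y.Srt s e g L → pos k L = d+1 →
    Y.W s d ≤ (1/8)^(k+1) ∧ e ≤ d ∧ d ≤ s := by
  intro L
  induction L with
  | nil => intro e g _ _ h; simp [pos] at h
  | cons a R ih =>
    obtain ⟨d', h⟩ := a
    intro e g hg ⟨h1, h2, h3, h4, h5, h6⟩ hp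
    unfold pos at hp
    split_ifs at hp with hk
    · have : d' = d := by omega
      subst this
      refine ⟨(h5 (by omega)).trans ?_, h1, h2⟩
      have i1 : Y.Om s - Y.Om e ≤ 1 := by
        have := Y.Om_le_one s; have := Y.Om_nonneg e; linarith
      have i2 : 0 ≤ Y.Om s - Y.Om e := by have := Y.Om_mono (h1.trans h2); linarith
      have i3 : ((1:ℝ)/8)^h ≤ (1/8)^(k+1) :=
        pow_le_pow_of_le_one (by norm_num) (by norm_num) hk
      have i4 : (0:ℝ) ≤ (1/8)^h := by positivity
      nlinarith
    · obtain ⟨a1, a2, a3⟩ := ih d' h (by omega) h6 hp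
      exact ⟨a1, by omega, a3⟩

theorem pos_ne_zero {k : ℕ} : ∀ L : List (ℕ × ℕ), (∃ a ∈ L, k < a.2) → pos k L ≠ 0 := by
  intro L
  induction L with
  | nil => rintro ⟨a, h, _⟩; simp at h
  | cons a R ih =>
    rintro ⟨b, hb, hk⟩
    unfold pos
    split_ifs with h
    · omega
    · rcases List.mem_cons.1 hb with rfl | hb
      · exact absurd hk h
      · exact ih ⟨b, hb, hk⟩

theorem mem_proc_top (s : ℕ) : ∀ L e g, (s+1, s+2) ∈ Y.proc s e g L := by
  intro L
  induction L with
  | nil => intro e g; simp [proc]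
  | cons a R ih =>
    intro e g
    obtain ⟨d, h⟩ := a
    unfold proc
    split_ifs
    · simp
    · exact List.mem_cons_of_mem _ (ih _ _)

theorem mem_st_top (s : ℕ) : (s, s+1) ∈ Y.st s := by
  cases s with
  | zero => simp [st]
  | succ s => exact Y.mem_proc_top s _ _ _

theorem pos_st_ne {k s : ℕ} (h : k ≤ s) : pos k (Y.st s) ≠ 0 :=
  pos_ne_zero _ ⟨_, Y.mem_st_top s, by simpa using (by omega : k < s+1)⟩

theorem pos_change {k s d : ℕ} (hc : Y.ch s d = false) : ∀ L e g, Y.Srt s e g L →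
    pos k L = d+1 → pos k (Y.proc s e g L) ≠ d+1 → ∃ j, Y.trg s e g L = Option.some j ∧ j ≤ d := by
  have hcm : ∀ d', d' ≤ d → Y.ch s d' = false := by
    intro d' h
    by_contra h'
    rw [Bool.not_eq_false] at h'
    rw [Y.ch_mono _ _ _ h h'] at hc
    exact absurd hc (by decide)
  have key : ∀ L e g, Y.Srt s e g L → pos k L = d+1 → e ≤ d := by
    intro L
    induction L with
    | nil => intro e g _ h; simp [pos] at h
    | cons a R ih =>
      obtain ⟨d', h⟩ := a
      intro e g ⟨h1, h2, h3, h4, h5, h6⟩ hp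
      unfold pos at hp
      split_ifs at hp with hk
      · omega
      · have := ih d' h h6 hp; omega
  intro L
  induction L with
  | nil => intro e g _ h; simp [pos] at h
  | cons a R ih =>
    obtain ⟨d', h⟩ := a
    intro e g hS hp hp'
    have hS0 := hS
    obtain ⟨h1, h2, h3, h4, h5, h6⟩ := hS
    have hd : d' ≤ d := by
      unfold pos at hp
      split_ifs at hp with hk
      · omega
      · exact key R d' h h6 hp
    have hcd := hcm d' hd
    have e1 : Y.h1 s d' h = h := by unfold Sys.h1; simp [hcd]
    unfold trg
    unfold proc at hp'
    rw [e1] at *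
    by_cases hlt : Y.nl s e g d' h < h
    · exact ⟨d', by simp [hlt], hd⟩
    · rw [if_neg (by simp [hcd, hlt])] at hp'
      rw [if_neg hlt, if_neg (by simp [hcd])]
      unfold pos at hp hp'
      split_ifs at hp hp' with hk
      · exact absurd hp hp'
      · exact ih d' h h6 hp hp'

end Sys

namespace Sys
variable (Y : Sys)

/-- position of the first entry, or `s` if there is none -/
def nxt (s : ℕ) : List (ℕ × ℕ) → ℕ
  | [] => s
  | (d, _) :: _ => d

theorem nxt_proc (s e g : ℕ) (L : List (ℕ × ℕ)) (h : nxt s L ≤ s) :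
    nxt s L ≤ nxt (s+1) (Y.proc s e g L) := by
  cases L with
  | nil => simp [proc, nxt]
  | cons a R =>
    obtain ⟨d, h⟩ := a
    unfold proc
    split_ifs <;> simp [nxt]

theorem nxt_le (s e g : ℕ) (L : List (ℕ × ℕ)) (h : Y.Srt s e g L) : nxt s L ≤ s := by
  cases L with
  | nil => simp [nxt]
  | cons a R => exact h.2.1

theorem le_nxt (s e g : ℕ) (L : List (ℕ × ℕ)) (he : e ≤ s) (h : Y.Srt s e g L) : e ≤ nxt s L := by
  cases L with
  | nil => simpa [nxt]
  | cons a R => exact h.1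

def Chg (s : ℕ) : ℕ → List (ℕ × ℕ) → ℝ → Finset ℕ → Prop
  | _, [], S, F => S = 0 ∧ F = ∅
  | e, (d, h) :: R, S, F => ∃ (Q : ℝ) (F1 : Finset ℕ) (S' : ℝ) (F' : Finset ℕ),
      Chg s d R S' F' ∧ S = Q + S' ∧ F = F1 ∪ F' ∧ Disjoint F1 F' ∧ 0 ≤ Q ∧ Q ≤ 2 * Y.wts F1 ∧
      Q ≤ 1/4 * (1/8)^h * (Y.Om (nxt s R) - Y.Om e) ∧
      ∀ p ∈ F1, d ≤ Y.nn p ∧ Y.nn p < nxt s R ∧ ∃ t ≤ s, Y.al p t = true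

theorem Chg_mem (s : ℕ) : ∀ L e g S F, Y.Srt s e g L → Y.Chg s e L S F → ∀ p ∈ F,
    nxt s L ≤ Y.nn p ∧ ∃ t ≤ s, Y.al p t = true := by
  intro L
  induction L with
  | nil => intro e g S F _ h p hp; rw [h.2] at hp; simp at hp
  | cons a R ih =>
    obtain ⟨d, h⟩ := a
    rintro e g S F ⟨h1, h2, h3, h4, h5, h6⟩ ⟨Q, F1, S', F', c1, c2, c3, c4, c5, c6, c7, c8⟩ p hp
    rw [c3, Finset.mem_union] at hp
    rcases hp with hp | hp
    · exact ⟨(c8 p hp).1, (c8 p hp).2.2⟩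
    · have := ih d h S' F' h6 c1 p hp
      have h7 := Y.le_nxt s d h R h2 h6
      exact ⟨by simpa [nxt] using h7.trans this.1, this.2⟩

theorem Chg_nonneg (s : ℕ) : ∀ L e S F, Y.Chg s e L S F → 0 ≤ S ∧ S ≤ 2 * Y.wts F := by
  intro L
  induction L with
  | nil => intro e S F h; rw [h.1, h.2]; simp [Sys0.wts]
  | cons a R ih =>
    obtain ⟨d, h⟩ := a
    rintro e S F ⟨Q, F1, S', F', c1, c2, c3, c4, c5, c6, c7, c8⟩
    have := ih d S' F' c1
    have hs : Y.wts F = Y.wts F1 + Y.wts F' := by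
      rw [c3]; exact Finset.sum_union c4
    constructor <;> linarith

theorem Chg_bound (s : ℕ) : ∀ R d h e g S F, Y.Srt s e g ((d,h)::R) → Y.Chg s e ((d,h)::R) S F →
    S ≤ 1/4 * (1/8)^h * (2 * Y.Om s - Y.Om d - Y.Om e) := by
  intro R
  induction R with
  | nil =>
    rintro d h e g S F ⟨h1, h2, h3, h4, h5, h6⟩ ⟨Q, F1, S', F', c1, c2, c3, c4, c5, c6, c7, c8⟩
    rw [c2, c1.1]
    refine (by linarith : Q + 0 ≤ Q).trans (c7.trans ?_)
    have := Y.Om_mono h2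
    have : (0:ℝ) ≤ 1/4*(1/8)^h := by positivity
    simp only [nxt]
    apply mul_le_mul_of_nonneg_left _ this
    linarith
  | cons a R ih =>
    obtain ⟨d', h'⟩ := a
    rintro d h e g S F ⟨h1, h2, h3, h4, h5, h6⟩ ⟨Q, F1, S', F', c1, c2, c3, c4, c5, c6, c7, c8⟩
    have i1 := ih d' h' d h S' F' h6 c1
    have i2 := Y.Om_mono h6.2.1
    have i3 := Y.Om_mono h6.1
    have i4 : (1/8:ℝ)^h' ≤ (1/8)^h := pow_le_pow_of_le_one (by norm_num) (by norm_num) h6.2.2.1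
    simp only [nxt] at c7
    have i5 : 1/4 * (1/8:ℝ)^h' * (2 * Y.Om s - Y.Om d' - Y.Om d) ≤
        1/4 * (1/8:ℝ)^h * (2 * Y.Om s - Y.Om d' - Y.Om d) := by
      apply mul_le_mul_of_nonneg_right _ (by linarith)
      linarith
    rw [c2]
    nlinarith

noncomputable def costSet (s : ℕ) (e g : ℕ) (L : List (ℕ × ℕ)) : Finset ℕ :=
  match Y.trg s e g L with
  | Option.none => ∅
  | Option.some j => (Y.aset s j).filter (fun p => Y.al p (s+1) = true)

theorem Chg_step (s : ℕ) : ∀ L e g S F, e ≤ s → g ≤ e+1 → Y.Srt s e g L → Y.Chg s e L S F →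
    ∃ S2 F2 D, Y.Chg (s+1) e (Y.proc s e g L) S2 F2 ∧
      S + Y.wts (Y.costSet s e g L) ≤ S2 + 2 * Y.wts D ∧ D ⊆ F ∧ Disjoint D F2 ∧
      (∀ p ∈ D, ∀ t, s < t → Y.al p t = false) ∧
      (∀ p ∈ F2, p ∈ F ∨ (Y.al p (s+1) = true ∧ nxt (s+1) (Y.proc s e g L) ≤ Y.nn p)) := by
  intro L
  induction L with
  | nil =>
    rintro e g S F he hg - ⟨rfl, rfl⟩
    refine ⟨0, ∅, ∅, ⟨0, ∅, 0, ∅, ⟨rfl, rfl⟩, ?_, ?_, ?_, ?_⟩, ?_, ?_, ?_, ?_, ?_⟩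
    · simp
    · simp
    · simp
    · simp only [nxt]
      have := Y.Om_mono (show e ≤ s+1 by omega)
      refine ⟨le_rfl, ?_, ?_, by simp⟩
      · simp [Sys0.wts]
      · apply mul_nonneg (by positivity) (by linarith)
    · simp [costSet, trg, Sys0.wts]
    · simp
    · simp
    · simp
    · simp
  | cons a R ih =>
    obtain ⟨d, h⟩ := a
    intro e g S F he hg hS hC
    have hS0 := hS
    have hC0 := hC
    obtain ⟨h1, h2, h3, h4, h5, h6⟩ := hS
    have hh : g ≤ Y.h1 s d h ∧ Y.h1 s d h ≤ d + 1 := by unfold Sys.h1; split_ifs <;> omega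
    have n1 := Y.nl_ge s e g d _ hh.1
    have n2 := Y.nl_le s e g d (Y.h1 s d h)
    have hT : Y.Om e ≤ Y.Om (s+1) := Y.Om_mono (by omega)
    have hT2 : Y.Om s ≤ Y.Om (s+1) := Y.Om_mono (by omega)
    have hT3 : Y.Om e ≤ Y.Om d := Y.Om_mono (by omega)
    by_cases hc : Y.ch s d = true
    · -- change case
      have hcost : Y.costSet s e g ((d,h)::R) = ∅ := by
        unfold costSet trg
        rw [if_pos hc]
        by_cases hlt : Y.nl s e g d (Y.h1 s d h) < Y.h1 s d h
        · rw [if_pos hlt]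
          simp only
          rw [Finset.filter_eq_empty_iff]
          intro p hp
          rw [Y.mem_aset] at hp
          have := Y.al_dead p s s (s+1) hp.1 le_rfl (Y.ch_mono _ _ _ hp.2 hc) (by omega)
          simp [this]
        · rw [if_neg hlt]
      rw [hcost]
      have hpr : Y.proc s e g ((d,h)::R) = [(d, Y.nl s e g d (Y.h1 s d h)), (s+1, s+2)] := by
        unfold proc; simp [hc]
      rw [hpr]
      refine ⟨0, ∅, F, ⟨0, ∅, 0, ∅, ⟨0, ∅, 0, ∅, ⟨rfl, rfl⟩, ?_, ?_, ?_, ?_⟩, ?_, ?_, ?_, ?_⟩, ?_, ?_, ?_, ?_, ?_⟩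
      · simp
      · simp
      · simp
      · refine ⟨le_rfl, by simp [Sys0.wts], ?_, by simp⟩
        simp only [nxt]
        apply mul_nonneg (by positivity)
        have := Y.Om_mono (show d ≤ s+1 by omega)
        linarith
      · simp
      · simp
      · simp
      · refine ⟨le_rfl, by simp [Sys0.wts], ?_, by simp⟩
        simp only [nxt]
        apply mul_nonneg (by positivity)
        linarith
      · have := Y.Chg_nonneg s _ _ _ _ hC0
        simp only [Sys0.wts, Finset.sum_empty] at *
        linarith [this.2]
      · exact subset_rfl
      · simp
      · intro p hp t ht
        obtain ⟨a1, r, a2, a3⟩ := Y.Chg_mem s _ _ _ _ _ hS0 hC0 p hp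
        exact Y.al_dead p r s t a3 a2 (Y.ch_mono _ _ _ a1 hc) ht
      · simp
    · have e1 : Y.h1 s d h = h := by unfold Sys.h1; simp [hc]
      rw [e1] at n1 n2
      by_cases hlt : Y.nl s e g d h < h
      · -- trigger
        have hcost : Y.costSet s e g ((d,h)::R) =
            (Y.aset s d).filter (fun p => Y.al p (s+1) = true) := by
          unfold costSet trg
          rw [e1, if_pos hlt]
        have hpr : Y.proc s e g ((d,h)::R) = [(d, Y.nl s e g d h), (s+1, s+2)] := by
          unfold proc; rw [e1]; simp [hlt]
        rw [hpr]
        set h2' := Y.nl s e g d h with hh2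
        have b1 := Y.Chg_bound s R d h e g S F hS0 hC0
        have b2 : Y.wts (Y.costSet s e g ((d,h)::R)) ≤ Y.W s d := by
          rw [hcost]; exact Y.wts_mono (Finset.filter_subset _ _)
        have b3 := h5 (by omega)
        have b4 := Y.nl_max s e g d h h hlt le_rfl he
        have b0 := (Y.Chg_nonneg s _ _ _ _ hC0).1
        have b00 := Y.wts_nonneg (Y.costSet s e g ((d,h)::R))
        have p1 : (0:ℝ) < (1/8)^h := by positivity
        set T := Y.Om (s+1) - Y.Om e with hTdef
        have T0 : 0 ≤ T := by simp only [hTdef]; linarith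
        have b5 : S ≤ 1/2 * ((1/8)^h * T) := by
          refine b1.trans ?_
          have : 1/4 * (1/8:ℝ)^h * (2 * Y.Om s - Y.Om d - Y.Om e) ≤ 1/4 * (1/8)^h * (2*T) := by
            apply mul_le_mul_of_nonneg_left _ (by positivity)
            simp only [hTdef]; linarith
          linarith
        have b6 : Y.W s d ≤ (1/8)^h * T := by
          refine b3.trans ?_
          apply mul_le_mul_of_nonneg_left _ p1.le
          simp only [hTdef]; linarith
        have p2 : 8 * (1/8:ℝ)^h ≤ (1/8)^h2' := by
          have : (1/8:ℝ)^h ≤ (1/8)^(h2'+1) := 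
            pow_le_pow_of_le_one (by norm_num) (by norm_num) hlt
          rw [pow_succ] at this
          linarith
        refine ⟨S + Y.wts (Y.costSet s e g ((d,h)::R)), Y.aset (s+1) d, ∅,
          ⟨S + Y.wts (Y.costSet s e g ((d,h)::R)), Y.aset (s+1) d, 0, ∅,
            ⟨0, ∅, 0, ∅, ⟨rfl, rfl⟩, ?_, ?_, ?_, ?_⟩, ?_, ?_, ?_, ?_⟩, ?_, ?_, ?_, ?_, ?_⟩
        · simp
        · simp
        · simp
        · refine ⟨le_rfl, by simp [Sys0.wts], ?_, by simp⟩
          simp only [nxt]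
          apply mul_nonneg (by positivity)
          have := Y.Om_mono (show d ≤ s+1 by omega)
          linarith
        · simp
        · simp
        · simp
        · refine ⟨by linarith, ?_, ?_, ?_⟩
          · have : Y.wts (Y.aset (s+1) d) = Y.W (s+1) d := rfl
            rw [this]; linarith
          · simp only [nxt, ← hTdef]
            have : 8 * (1/8:ℝ)^h * T ≤ (1/8)^h2' * T := mul_le_mul_of_nonneg_right p2 T0
            have : 0 ≤ (1/8:ℝ)^h * T := by positivity
            linarith
          · intro p hp
            rw [Y.mem_aset] at hp
            exact ⟨hp.2, Y.al_nn _ _ hp.1, s+1, le_rfl, hp.1⟩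
        · simp [Sys0.wts]
        · simp
        · simp
        · simp
        · intro p hp
          rw [Y.mem_aset] at hp
          exact Or.inr ⟨hp.1, by simpa [nxt] using hp.2⟩
      · -- continue
        have hcost : Y.costSet s e g ((d,h)::R) = Y.costSet s d h R := by
          unfold costSet
          conv_lhs => unfold trg
          rw [e1, if_neg hlt, if_neg hc]
        have hpr : Y.proc s e g ((d,h)::R) = (d,h) :: Y.proc s d h R := by
          conv_lhs => unfold proc
          rw [e1, if_neg (by tauto)]
        rw [hpr, hcost]
        obtain ⟨Q, F1, S', F', c1, c2, c3, c4, c5, c6, c7, c8⟩ := hC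
        obtain ⟨S2, F2, D, q1, q2, q3, q4, q5, q6⟩ := ih d h S' F' h2 (by omega) h6 c1
        have hx := Y.nxt_proc s d h R (Y.nxt_le s d h R h6)
        have hd12 : Disjoint F1 F2 := by
          rw [Finset.disjoint_left]
          intro p hp hp2
          rcases q6 p hp2 with h | h
          · exact Finset.disjoint_left.1 c4 hp h
          · have := (c8 p hp).2.1
            omega
        refine ⟨Q + S2, F1 ∪ F2, D, ⟨Q, F1, S2, F2, q1, rfl, rfl, hd12, c5, c6, ?_, ?_⟩, ?_, ?_, ?_, q5, ?_⟩
        · refine c7.trans ?_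
          apply mul_le_mul_of_nonneg_left _ (by positivity)
          have := Y.Om_mono hx
          linarith
        · intro p hp
          obtain ⟨a1, a2, t, a3, a4⟩ := c8 p hp
          exact ⟨a1, by omega, t, by omega, a4⟩
        · rw [c2]; linarith
        · rw [c3]; exact q3.trans Finset.subset_union_right
        · rw [Finset.disjoint_union_right]
          refine ⟨?_, q4⟩
          exact (Finset.disjoint_of_subset_right q3 c4).symm
        · intro p hp
          rw [c3]
          rcases Finset.mem_union.1 hp with hp | hp
          · exact Or.inl (Finset.mem_union_left _ hp)
          · rcases q6 p hp with hq | hq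
            · exact Or.inl (Finset.mem_union_right _ hq)
            · refine Or.inr ⟨hq.1, ?_⟩
              have h7 : d ≤ nxt s R := Y.le_nxt s d h R h2 h6
              simp only [nxt]
              omega

theorem cost_bound (s : ℕ) : 
    ∑ t ∈ Finset.range s, Y.wts (Y.costSet t 0 0 (Y.st t)) ≤ 2 := by
  have key : ∃ S F Bn, Y.Chg s 0 (Y.st s) S F ∧ Disjoint Bn F ∧
      (∀ p ∈ Bn, (∃ t, Y.al p t = true) ∧ ∀ t, s ≤ t → Y.al p t = false) ∧
      ∑ t ∈ Finset.range s, Y.wts (Y.costSet t 0 0 (Y.st t)) ≤ S + 2 * Y.wts Bn := by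
    induction s with
    | zero =>
      refine ⟨0, ∅, ∅, ⟨0, ∅, 0, ∅, ⟨rfl, rfl⟩, by simp, by simp, by simp, le_rfl, ?_, ?_, ?_⟩, ?_, ?_, ?_⟩
      · simp [Sys0.wts]
      · simp [nxt]
      · simp
      · simp
      · simp
      · simp [Sys0.wts]
    | succ s ih =>
      obtain ⟨S, F, Bn, a1, a2, a3, a4⟩ := ih
      obtain ⟨S2, F2, D, q1, q2, q3, q4, q5, q6⟩ :=
        Y.Chg_step s (Y.st s) 0 0 S F (by omega) (by omega) (Y.Srt_st s) a1
      refine ⟨S2, F2, Bn ∪ D, q1, ?_, ?_, ?_⟩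
      · rw [Finset.disjoint_union_left]
        refine ⟨?_, q4⟩
        rw [Finset.disjoint_left]
        intro p hp hp2
        rcases q6 p hp2 with h | h
        · exact Finset.disjoint_left.1 a2 hp h
        · have := (a3 p hp).2 (s+1) (by omega)
          rw [this] at h
          exact absurd h.1 (by decide)
      · intro p hp
        rcases Finset.mem_union.1 hp with hp | hp
        · exact ⟨(a3 p hp).1, fun t ht => (a3 p hp).2 t (by omega)⟩
        · obtain ⟨_, t, _, ht⟩ := Y.Chg_mem s _ _ _ _ _ (Y.Srt_st s) a1 p (q3 hp)
          exact ⟨⟨t, ht⟩, fun t ht => q5 p hp t (by omega)⟩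
      · have : Y.wts (Bn ∪ D) = Y.wts Bn + Y.wts D :=
          Finset.sum_union (Finset.disjoint_of_subset_right q3 a2)
        rw [Finset.sum_range_succ, this]
        linarith
  obtain ⟨S, F, Bn, a1, a2, a3, a4⟩ := key
  have h1 := (Y.Chg_nonneg s _ _ _ _ a1).2
  have h2 : Y.wts (Bn ∪ F) = Y.wts Bn + Y.wts F := Finset.sum_union a2
  have h3 : Y.wts (Bn ∪ F) ≤ 1 := by
    apply Y.wts_ever
    intro p hp
    rcases Finset.mem_union.1 hp with hp | hp
    · exact (a3 p hp).1
    · obtain ⟨_, t, _, ht⟩ := Y.Chg_mem s _ _ _ _ _ (Y.Srt_st s) a1 p hp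
      exact ⟨t, ht⟩
  linarith

end Sys

namespace Sys
variable (Y : Sys)

/-! ### Convergence -/

def Pass (t : ℕ) : ℕ → ℕ → List (ℕ × ℕ) → Prop
  | _, _, [] => True
  | e, g, (d, h) :: R => Y.ch t d = false ∧ Y.nl t e g d h = h ∧ Pass t d h R

def lst (e g : ℕ) : List (ℕ × ℕ) → ℕ × ℕ
  | [] => (e, g)
  | (d, h) :: R => lst d h R

theorem lst_append (d h : ℕ) : ∀ P e g, lst e g (P ++ [(d,h)]) = (d,h) := by
  intro P
  induction P with
  | nil => intro e g; rfl
  | cons a P ih => intro e g; exact ih _ _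

theorem Pass_append (t d h : ℕ) : ∀ P e g, Y.Pass t e g P → Y.ch t d = false →
    Y.nl t (lst e g P).1 (lst e g P).2 d h = h → Y.Pass t e g (P ++ [(d,h)]) := by
  intro P
  induction P with
  | nil => intro e g _ h1 h2; exact ⟨h1, h2, trivial⟩
  | cons a P ih => 
    intro e g hp h1 h2
    exact ⟨hp.1, hp.2.1, ih _ _ hp.2.2 h1 h2⟩

theorem proc_append (t : ℕ) (R : List (ℕ × ℕ)) : ∀ P e g, Y.Pass t e g P →
    Y.proc t e g (P ++ R) = P ++ Y.proc t (lst e g P).1 (lst e g P).2 R := by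
  intro P
  induction P with
  | nil => intro e g _; rfl
  | cons a P ih =>
    obtain ⟨d, h⟩ := a
    intro e g hp
    obtain ⟨h1, h2, h3⟩ := hp
    have e1 : Y.h1 t d h = h := by unfold Sys.h1; simp [h1]
    simp only [List.cons_append]
    conv_lhs => unfold proc
    rw [e1, h2, if_neg (by simp [h1]), ih d h h3]
    rfl

theorem ev_append (k t : ℕ) (R : List (ℕ × ℕ)) : ∀ P e g, Y.Pass t e g P →
    Y.ev k t e g (P ++ R) = Y.ev k t (lst e g P).1 (lst e g P).2 R := by
  intro P
  induction P with
  | nil => intro e g _; rfl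
  | cons a P ih =>
    obtain ⟨d, h⟩ := a
    intro e g hp
    obtain ⟨h1, h2, h3⟩ := hp
    have e1 : Y.h1 t d h = h := by unfold Sys.h1; simp [h1]
    simp only [List.cons_append]
    conv_lhs => unfold ev
    rw [e1, h2, if_neg (by omega), if_neg (by simp [h1]), ih d h h3]
    rfl

def Fz (k : ℕ) (P : List (ℕ × ℕ)) (s : ℕ) : Prop :=
  Y.st s = P ++ [(s, s+1)] ∧ (∀ t, s ≤ t → Y.Pass t 0 0 P) ∧ ∀ a ∈ P, a.2 ≤ k

theorem antitone_const (f : ℕ → ℕ) (n0 : ℕ) (h : ∀ n, n0 ≤ n → f (n+1) ≤ f n) :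
    ∃ N, n0 ≤ N ∧ ∀ n, N ≤ n → f (n+1) = f n := by
  have hne : ∃ v, ∃ n, n0 ≤ n ∧ f n = v := ⟨_, n0, le_rfl, rfl⟩
  obtain ⟨N, hN, hv⟩ := Nat.find_spec hne
  refine ⟨N, hN, ?_⟩
  have anti : ∀ n, N ≤ n → f n = Nat.find hne := by
    intro n hn
    have h1 : f n ≤ f N := by
      induction n, hn using Nat.le_induction with
      | base => exact le_rfl
      | succ m hm ih => exact (h m (by omega)).trans ih
    have h2 := Nat.find_min' hne ⟨n, by omega, rfl⟩
    omega
  intro n hn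
  rw [anti n hn, anti (n+1) (by omega)]

/-- successive levels at the position `s` -/
def hs (s e g : ℕ) : ℕ → ℕ
  | 0 => s+1
  | n+1 => Y.nl (s+n) e g s (Y.h1 (s+n) s (hs s e g n))

theorem st_hs {k s : ℕ} {P : List (ℕ × ℕ)} (hF : Y.Fz k P s) (n : ℕ) :
    ∃ R, Y.st (s+n) = P ++ (s, Y.hs s (lst 0 0 P).1 (lst 0 0 P).2 n) :: R := by
  obtain ⟨f1, f2, f3⟩ := hF
  induction n with
  | zero => exact ⟨[], f1⟩
  | succ n ih =>
    obtain ⟨R, hR⟩ := ih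
    have : Y.st (s+(n+1)) = Y.proc (s+n) 0 0 (Y.st (s+n)) := rfl
    rw [this, hR, Y.proc_append _ _ P 0 0 (f2 _ (by omega))]
    conv in Y.proc _ _ _ _ => unfold proc
    split_ifs with hc
    · exact ⟨_, rfl⟩
    · push Not at hc
      have e1 : ∀ h, Y.h1 (s+n) s h = h := by intro h; unfold Sys.h1; simp [hc.1]
      simp only [e1] at hc
      have := Y.nl_le (s+n) (lst 0 0 P).1 (lst 0 0 P).2 s (Y.hs s (lst 0 0 P).1 (lst 0 0 P).2 n)
      have e2 : Y.hs s (lst 0 0 P).1 (lst 0 0 P).2 (n+1) = Y.hs s (lst 0 0 P).1 (lst 0 0 P).2 n := by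
        conv_lhs => unfold hs
        rw [e1]; omega
      rw [e2]
      exact ⟨_, rfl⟩

theorem Fz_step {k s : ℕ} {P : List (ℕ × ℕ)} (hF : Y.Fz k P s) :
    (∃ x, ∀ t, x ≤ t → pos k (Y.st t) = pos k (Y.st x)) ∨
    ((k ≤ s → ∃ t, s ≤ t ∧ Y.ev k t 0 0 (Y.st t) = Option.some ((lst 0 0 P).1, s) ∧ 
        ∀ t', t < t' → Y.ch t' s = false) ∧
      ∃ h s', s < s' ∧ Y.Fz k (P ++ [(s,h)]) s') := by
  have hF0 := hF
  obtain ⟨f1, f2, f3⟩ := hF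
  set e := (lst 0 0 P).1 with he
  set g := (lst 0 0 P).2 with hg
  have hsucc : ∀ n, Y.hs s e g (n+1) = Y.nl (s+n) e g s (Y.h1 (s+n) s (Y.hs s e g n)) := fun n => rfl
  have hst := fun n => Y.st_hs hF0 n
  rw [← he, ← hg] at hst
  obtain ⟨s0, hs0⟩ := Y.ch_fin s
  have e1 : ∀ n, Y.ch (s+n) s = false → ∀ h, Y.h1 (s+n) s h = h := by
    intro n hn h; unfold Sys.h1; simp [hn]
  have hle : ∀ n, Y.ch (s+n) s = false → Y.hs s e g (n+1) ≤ Y.hs s e g n := by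
    intro n hn
    rw [hsucc, e1 n hn]; exact Y.nl_le _ _ _ _ _
  obtain ⟨N0, hN0, hN1⟩ := antitone_const (Y.hs s e g) s0 (fun n hn => hle n (hs0 _ (by omega)))
  have hex : ∃ N, ∀ n, N ≤ n → Y.ch (s+n) s = false ∧ Y.hs s e g (n+1) = Y.hs s e g n :=
    ⟨N0, fun n hn => ⟨hs0 _ (by omega), hN1 n hn⟩⟩
  have hconst : ∀ N, (∀ n, N ≤ n → Y.ch (s+n) s = false ∧ Y.hs s e g (n+1) = Y.hs s e g n) →
      ∀ n, N ≤ n → Y.hs s e g n = Y.hs s e g N := by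
    intro N hN n hn
    induction n, hn using Nat.le_induction with
    | base => rfl
    | succ m hm ih => rw [(hN m hm).2, ih]
  -- the extension
  have hext : ∃ n s', s < s' ∧ Y.st s' = P ++ [(s, Y.hs s e g n), (s', s'+1)] ∧
      (∀ m, n ≤ m → Y.hs s e g m = Y.hs s e g n) ∧ n ≤ s' - s ∧
      (∀ m, n ≤ m → Y.ch (s+m) s = false) := by
    have hm := Nat.find_spec hex
    rcases hz : Nat.find hex with _ | m
    · rw [hz] at hm
      refine ⟨0, s+1, by omega, ?_, fun m _ => hconst 0 hm m (by omega), by omega, fun m h => (hm m h).1⟩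
      have : Y.st (s+1) = Y.proc s 0 0 (Y.st s) := rfl
      rw [this, f1, Y.proc_append _ _ P 0 0 (f2 _ (by omega)), ← he, ← hg]
      have h0 := hm 0 le_rfl
      have h00 : Y.ch s s = false := h0.1
      have h01 := e1 0 h0.1
      have h02 := h0.2
      rw [hsucc, h01] at h02
      simp only [Nat.add_zero] at h02 h01
      conv in Y.proc _ _ _ _ => unfold proc
      have h03 : Y.hs s e g 0 = s + 1 := rfl
      rw [h03] at h02
      rw [h03, h01, h02, if_neg (by simp [h00])]
      rfl
    · rw [hz] at hm
      have hnot := Nat.find_min hex (m := m) (by omega)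
      refine ⟨m+1, s+(m+1), by omega, ?_, hconst (m+1) hm, by omega, fun m h => (hm m h).1⟩
      have hbad : Y.ch (s+m) s = true ∨ Y.hs s e g (m+1) < Y.h1 (s+m) s (Y.hs s e g m) := by
        by_contra hcon
        push Not at hcon
        apply hnot
        intro n hn
        rcases Nat.eq_or_lt_of_le hn with rfl | hlt
        · have c1 : Y.ch (s+m) s = false := by simpa using hcon.1
          refine ⟨c1, le_antisymm (hle m c1) ?_⟩
          have := hcon.2
          rwa [e1 m c1] at this
        · exact hm n hlt
      obtain ⟨R, hR⟩ := hst m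
      have : Y.st (s+(m+1)) = Y.proc (s+m) 0 0 (Y.st (s+m)) := rfl
      rw [this, hR, Y.proc_append _ _ P 0 0 (f2 _ (by omega)), ← he, ← hg]
      conv in Y.proc _ _ _ _ => unfold proc
      rw [hsucc] at hbad
      rw [if_pos hbad, hsucc]
      rfl
  obtain ⟨n, s', hs', hst', hc, hns, hch⟩ := hext
  by_cases hk : k < Y.hs s e g n
  · left
    refine ⟨s+n, fun t ht => ?_⟩
    have key : ∀ m, n ≤ m → pos k (Y.st (s+m)) = s+1 := by
      intro m hm
      obtain ⟨R, hR⟩ := hst m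
      rw [hR, pos_append k P _ f3]
      unfold pos
      rw [hc m hm, if_pos hk]
    obtain ⟨m, rfl⟩ := Nat.exists_eq_add_of_le (show s ≤ t by omega)
    rw [key m (by omega), key n le_rfl]
  · right
    push Not at hk
    constructor
    · intro hks
      have hex2 : ∃ N, ∀ m, N ≤ m → Y.hs s e g m ≤ k ∧ Y.ch (s+m) s = false :=
        ⟨n, fun m hm => ⟨by rw [hc m hm]; exact hk, hch m hm⟩⟩
      have hm := Nat.find_spec hex2
      rcases hz : Nat.find hex2 with _ | m
      · rw [hz] at hm
        have := (hm 0 le_rfl).1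
        have h03 : Y.hs s e g 0 = s + 1 := rfl
        omega
      · rw [hz] at hm
        have hnot := Nat.find_min hex2 (m := m) (by omega)
        refine ⟨s+m, by omega, ?_, ?_⟩
        · obtain ⟨R, hR⟩ := hst m
          rw [hR, Y.ev_append _ _ _ P 0 0 (f2 _ (by omega)), ← he, ← hg]
          unfold ev
          rw [if_pos]
          refine ⟨(hm (m+1) le_rfl).1, ?_⟩
          by_contra hcon
          push Not at hcon
          apply hnot
          intro r hr
          rcases Nat.eq_or_lt_of_le hr with rfl | hlt
          · unfold Sys.h1 at hcon
            split_ifs at hcon with hcc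
            · omega
            · exact ⟨hcon, by simpa using hcc⟩
          · exact hm r hlt
        · intro t' ht'
          obtain ⟨r, rfl⟩ := Nat.exists_eq_add_of_le (show s ≤ t' by omega)
          exact (hm r (by omega)).2
    · refine ⟨Y.hs s e g n, s', hs', by rw [hst']; simp, ?_, ?_⟩
      · intro t ht
        obtain ⟨m, rfl⟩ := Nat.exists_eq_add_of_le (show s ≤ t by omega)
        apply Y.Pass_append _ _ _ P 0 0 (f2 _ (by omega)) (hch m (by omega))
        rw [← he, ← hg]
        have h1 := hsucc m
        rw [e1 m (hch m (by omega)), hc m (by omega), hc (m+1) (by omega)] at h1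
        exact h1.symm
      · intro a ha
        rcases List.mem_append.1 ha with ha | ha
        · exact f3 a ha
        · simp only [List.mem_singleton] at ha
          rw [ha]; exact hk

theorem converge (k : ℕ) :
    (∃ x, ∀ t, x ≤ t → pos k (Y.st t) = pos k (Y.st x)) ∨
    ∀ t0, k < t0 → ∃ t e d, Y.ev k t 0 0 (Y.st t) = Option.some (e, d) ∧ e < t0 ∧ t0 ≤ d ∧ d ≤ t ∧
      ∀ t', t < t' → Y.ch t' d = false := by
  by_contra hcon
  push Not at hcon
  obtain ⟨hA, t0, ht0, hB⟩ := hcon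
  have key : ∀ j s P, t0 - s = j → Y.Fz k P s → (lst 0 0 P).1 < t0 → False := by
    intro j
    induction j using Nat.strong_induction_on with
    | _ j ih =>
      intro s P hj hF hl
      rcases Y.Fz_step hF with ⟨x, hx⟩ | ⟨h1, h, s', hs', hF'⟩
      · obtain ⟨t, h1, h2⟩ := hA x
        exact h2 (hx t h1)
      · by_cases hst : t0 ≤ s
        · obtain ⟨t, a0, a1, a2⟩ := h1 (by omega)
          obtain ⟨t', b1, b2⟩ := hB t _ _ a1 hl hst a0
          exact b2 (a2 t' b1)
        · have hlt : t0 - s' < j := by clear hA hB h1 ih; omega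
          refine ih (t0 - s') hlt s' _ rfl hF' ?_
          rw [lst_append]
          simp only; omega
  refine key _ 0 [] rfl ⟨rfl, fun _ _ => trivial, by simp⟩ ?_
  simp only [lst]; omega

/-! ### Events -/

theorem ev_weight {k s e' d : ℕ} : ∀ L e g, Y.Srt s e g L → e ≤ s →
    Y.ev k s e g L = Option.some (e', d) →
    (1/8)^(k+1) * (Y.Om (s+1) - Y.Om e') < Y.W (s+1) d ∧ d ≤ s ∧ e' ≤ d := by
  intro L
  induction L with
  | nil => intro e g _ _ h; simp [ev] at h
  | cons a R ih =>
    obtain ⟨d0, h⟩ := a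
    intro e g ⟨h1, h2, h3, h4, h5, h6⟩ he hv
    unfold ev at hv
    split_ifs at hv with hc1 hc2
    · simp only [Option.some.injEq, Prod.mk.injEq] at hv
      obtain ⟨rfl, rfl⟩ := hv
      exact ⟨Y.nl_max s e g d0 (Y.h1 s d0 h) (k+1) (by omega) (by omega) he, h2, h1⟩
    · exact ih d0 h h6 h2 hv

theorem ev_after {k s : ℕ} {o : ℕ × ℕ} : ∀ L e g, Y.Srt s e g L → e ≤ s → g ≤ e + 1 →
    Y.ev k s e g L = Option.some o →
    g ≤ k ∧ ∀ a ∈ Y.proc s e g L, a.1 = s+1 ∨ a.2 ≤ k := by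
  intro L
  induction L with
  | nil => intro e g _ _ _ h; simp [ev] at h
  | cons a R ih =>
    obtain ⟨d0, h⟩ := a
    intro e g ⟨h1, h2, h3, h4, h5, h6⟩ he hg hv
    have hh : g ≤ Y.h1 s d0 h := by unfold Sys.h1; split_ifs <;> omega
    have n1 := Y.nl_ge s e g d0 _ hh
    unfold ev at hv
    unfold proc
    by_cases hc1 : Y.nl s e g d0 (Y.h1 s d0 h) ≤ k ∧ k < Y.h1 s d0 h
    · refine ⟨by omega, ?_⟩
      rw [if_pos (Or.inr (by omega))]
      intro a ha
      simp only [List.mem_cons, List.not_mem_nil, or_false] at ha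
      rcases ha with rfl | rfl
      · exact Or.inr hc1.1
      · exact Or.inl rfl
    · rw [if_neg hc1] at hv
      split_ifs at hv ⊢ with hc2
      obtain ⟨a1, a2⟩ := ih d0 h h6 h2 h4 hv
      refine ⟨by omega, ?_⟩
      intro a ha
      rcases List.mem_cons.1 ha with rfl | ha
      · exact Or.inr a1
      · exact a2 a ha

theorem ev_mem {k s e' d : ℕ} : ∀ L e g,
    Y.ev k s e g L = Option.some (e', d) → Y.ch s d = false → ∃ a ∈ L, a.1 = d ∧ k < a.2 := by
  intro L
  induction L with
  | nil => intro e g h; simp [ev] at h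
  | cons a R ih =>
    obtain ⟨d0, h⟩ := a
    intro e g hv hc
    unfold ev at hv
    split_ifs at hv with hc1 hc2
    · simp only [Option.some.injEq, Prod.mk.injEq] at hv
      obtain ⟨rfl, rfl⟩ := hv
      refine ⟨(d0, h), by simp, rfl, ?_⟩
      unfold Sys.h1 at hc1
      simpa [hc] using hc1.2
    · obtain ⟨a, ha, hb⟩ := ih d0 h hv hc
      exact ⟨a, List.mem_cons_of_mem _ ha, hb⟩

theorem proc_mem {s : ℕ} : ∀ L e g, ∀ a ∈ Y.proc s e g L, 
    a.1 = s+1 ∨ ∃ b ∈ L, a.1 = b.1 ∧ (Y.ch s b.1 = true ∨ a.2 ≤ b.2) := by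
  intro L
  induction L with
  | nil => intro e g a ha; simp [proc] at ha; left; rw [ha]
  | cons c R ih =>
    obtain ⟨d0, h⟩ := c
    intro e g a ha
    unfold proc at ha
    split_ifs at ha with hc
    · simp only [List.mem_cons, List.not_mem_nil, or_false] at ha
      rcases ha with rfl | rfl
      · right
        refine ⟨(d0, h), by simp, rfl, ?_⟩
        by_cases hcc : Y.ch s d0 = true
        · exact Or.inl hcc
        · right
          have := Y.nl_le s e g d0 (Y.h1 s d0 h)
          unfold Sys.h1 at *
          simpa [hcc] using this
      · exact Or.inl rfl
    · rcases List.mem_cons.1 ha with rfl | ha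
      · exact Or.inr ⟨(d0, h), by simp, rfl, Or.inr le_rfl⟩
      · rcases ih d0 h a ha with h1 | ⟨b, hb, h1⟩
        · exact Or.inl h1
        · exact Or.inr ⟨b, List.mem_cons_of_mem _ hb, h1⟩

theorem ev_disjoint {k t t' e d e' d' : ℕ} (htt : t < t')
    (h1 : Y.ev k t 0 0 (Y.st t) = Option.some (e, d))
    (h2 : Y.ev k t' 0 0 (Y.st t') = Option.some (e', d')) :
    Disjoint (Y.aset (t+1) d) (Y.aset (t'+1) d') := by
  rw [Finset.disjoint_left]
  intro p hp hp'
  rw [Y.mem_aset] at hp hp'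
  have hch : ∀ r, t+1 ≤ r → r ≤ t' → ∀ x, x ≤ Y.nn p → Y.ch r x = false := by
    intro r hr hr' x hx
    have := Y.not_ch_of_al hp.1 hr (show r < t'+1 by omega) hp'.1
    by_contra h
    rw [Bool.not_eq_false] at h
    rw [Y.ch_mono _ _ _ hx h] at this
    exact absurd this (by decide)
  have hnn := Y.al_nn _ _ hp.1
  have inv : ∀ r, t+1 ≤ r → r ≤ t' → ∀ a ∈ Y.st r, a.1 ≤ Y.nn p → a.2 ≤ k := by
    intro r hr
    induction r, hr using Nat.le_induction with
    | base =>
      intro _ a ha hle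
      have := (Y.ev_after _ _ _ (Y.Srt_st t) (by omega) (by omega) h1).2 a ha
      rcases this with h | h
      · omega
      · exact h
    | succ r hr ih =>
      intro hr' a ha hle
      rcases Y.proc_mem _ _ _ a ha with h | ⟨b, hb, h3, h4⟩
      · omega
      · have hb2 := ih (by omega) b hb (by omega)
        rcases h4 with h4 | h4
        · rw [hch r hr (by omega) b.1 (by omega)] at h4
          exact absurd h4 (by decide)
        · omega
  obtain ⟨a, ha, ha1, ha2⟩ := Y.ev_mem _ _ _ h2 (hch t' (by omega) le_rfl d' hp'.2)
  have := inv t' (by omega) le_rfl a ha (by omega)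
  omega

theorem ev_sum (k N : ℕ) : ∑ t ∈ Finset.range N,
    (match Y.ev k t 0 0 (Y.st t) with
      | Option.none => (0:ℝ)
      | Option.some o => (1/8)^(k+1) * (Y.Om o.2 - Y.Om o.1)) ≤ 1 := by
  let G : ℕ → Finset ℕ := fun t => match Y.ev k t 0 0 (Y.st t) with
      | Option.none => ∅
      | Option.some o => Y.aset (t+1) o.2
  have hG : ∑ t ∈ Finset.range N, Y.wts (G t) = Y.wts ((Finset.range N).biUnion G) := by
    unfold Sys0.wts
    rw [Finset.sum_biUnion]
    intro t _ t' _ hne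
    have main : ∀ t t', t < t' → Disjoint (G t) (G t') := by
      intro t t' hlt
      simp only [G]
      rcases h1 : Y.ev k t 0 0 (Y.st t) with _ | ⟨e, d⟩
      · simp
      · rcases h2 : Y.ev k t' 0 0 (Y.st t') with _ | ⟨e', d'⟩
        · simp
        · exact Y.ev_disjoint hlt h1 h2
    rcases lt_or_gt_of_ne hne with h | h
    · exact main _ _ h
    · exact (main _ _ h).symm
  have hle : Y.wts ((Finset.range N).biUnion G) ≤ 1 := by
    apply Y.wts_ever
    intro p hp
    obtain ⟨t, _, hp⟩ := Finset.mem_biUnion.1 hp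
    simp only [G] at hp
    rcases h1 : Y.ev k t 0 0 (Y.st t) with _ | ⟨e, d⟩
    · simp [h1] at hp
    · simp only [h1] at hp
      exact ⟨t+1, (Y.mem_aset.1 hp).1⟩
  refine le_trans ?_ hle
  rw [← hG]
  apply Finset.sum_le_sum
  intro t _
  simp only [G]
  rcases h1 : Y.ev k t 0 0 (Y.st t) with _ | ⟨e, d⟩
  · simp [Sys0.wts]
  · obtain ⟨a1, a2, a3⟩ := Y.ev_weight _ _ _ (Y.Srt_st t) (by omega) h1
    refine le_trans ?_ a1.le
    simp only
    apply mul_le_mul_of_nonneg_left _ (by positivity)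
    have := Y.Om_mono (show d ≤ t+1 by omega)
    linarith

end Sys

/-! ### Kraft–Chaitin -/

theorem primrec_pow : Primrec₂ (fun a b : ℕ => a ^ b) := by
  have h : Primrec₂ (fun a b : ℕ => Nat.rec (motive := fun _ => ℕ) 1 (fun _ r => r * a) b) := by
    have := Primrec.nat_rec (α := ℕ) (β := ℕ) (f := fun _ => 1) (g := fun a p => p.2 * a)
      (Primrec.const 1) 
      (Primrec.nat_mul.comp (Primrec.snd.comp Primrec.snd) Primrec.fst)
    exact this
  refine h.of_eq ?_
  intro a b
  induction b with
  | zero => rfl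
  | succ b ih => rw [pow_succ, ← ih]

def val : Str → ℕ
  | [] => 0
  | b :: r => b.toNat * 2 ^ r.length + val r

theorem val_lt : ∀ r : Str, val r < 2 ^ r.length
  | [] => by simp [val]
  | b :: r => by
    have := val_lt r
    simp only [val, List.length_cons, pow_succ]
    cases b <;> simp <;> omega

theorem val_append : ∀ r t : Str, val (r ++ t) = val r * 2 ^ t.length + val t
  | [], t => by simp [val]
  | b :: r, t => by
    have := val_append r t
    simp only [val, List.cons_append, List.length_append, this, pow_add]
    ring

def bst (l c : ℕ) : ℕ × Str :=
  Nat.rec (c, []) (fun _ p => (p.1 / 2, decide (p.1 % 2 = 1) :: p.2)) l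

theorem bst_spec (l c : ℕ) : (bst l c).2.length = l ∧ val (bst l c).2 + 2 ^ l * (bst l c).1 = c := by
  induction l with
  | zero => simp [bst, val]
  | succ l ih =>
    have e : bst (l+1) c = ((bst l c).1 / 2, decide ((bst l c).1 % 2 = 1) :: (bst l c).2) := rfl
    rw [e]
    obtain ⟨h1, h2⟩ := ih
    refine ⟨by simp [h1], ?_⟩
    simp only [val, h1]
    have h3 : (decide ((bst l c).1 % 2 = 1)).toNat = (bst l c).1 % 2 := by
      rcases Nat.mod_two_eq_zero_or_one (bst l c).1 with h | h <;> simp [h]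
    rw [h3]
    conv_rhs => rw [← h2]
    conv_rhs => rw [← Nat.div_add_mod (bst l c).1 2]
    ring

theorem bst_val {l c : ℕ} (h : c < 2 ^ l) : val (bst l c).2 = c := by
  obtain ⟨_, h2⟩ := bst_spec l c
  have : (bst l c).1 = 0 := by
    by_contra hne
    have : 1 ≤ (bst l c).1 := Nat.one_le_iff_ne_zero.2 hne
    have := Nat.mul_le_mul_left (2^l) this
    omega
  rw [this] at h2; simpa using h2

theorem bst_primrec : Primrec₂ bst := by
  have h2 : PrimrecRel (fun a b : ℕ => a = b) := Primrec.eq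
  have := Primrec.nat_rec (α := ℕ) (β := ℕ × Str) (f := fun c => (c, []))
    (g := fun _ p => (p.2.1 / 2, decide (p.2.1 % 2 = 1) :: p.2.2))
    (Primrec.pair Primrec.id (Primrec.const []))
    (by
      have hp : Primrec (fun q : ℕ × (ℕ × (ℕ × Str)) => q.2.2.1) :=
        Primrec.fst.comp (Primrec.snd.comp Primrec.snd)
      have hd : Primrec (fun q : ℕ × (ℕ × (ℕ × Str)) => decide (q.2.2.1 % 2 = 1)) := by
        have := (h2.comp (Primrec.nat_mod.comp hp (Primrec.const 2)) (Primrec.const 1)).decide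
        exact this.of_eq fun _ => by congr
      exact Primrec.pair (Primrec.nat_div.comp hp (Primrec.const 2))
        (Primrec.list_cons.comp hd (Primrec.snd.comp (Primrec.snd.comp Primrec.snd))))
  exact this.swap

abbrev Reqs := ℕ → Option (ℕ × Str)

noncomputable def rwt (f : Reqs) (i : ℕ) : ℝ :=
  match f i with
  | Option.none => 0
  | Option.some a => (1/2)^a.1

def kst (f : Reqs) (i : ℕ) : ℕ × ℕ :=
  Nat.rec (0, 0) (fun i p => match f i with
    | Option.none => p
    | Option.some a => (p.1 * 2 ^ a.1 + 2 * 2 ^ p.2, p.2 + a.1)) i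

def kcode (p : ℕ × ℕ) (l : ℕ) : Str := (bst l ((p.1 * 2 ^ l + 2 ^ p.2 - 1) / 2 ^ p.2)).2

def kG (f : Reqs) (i : ℕ) : Option (Str × Str) := (f i).map fun a => (kcode (kst f i) a.1, a.2)

theorem kst_real (f : Reqs) (i : ℕ) :
    ((kst f i).1 : ℝ) / 2 ^ (kst f i).2 = 2 * ∑ j ∈ Finset.range i, rwt f j := by
  induction i with
  | zero => simp [kst]
  | succ i ih =>
    rw [Finset.sum_range_succ, mul_add, ← ih]
    have e : kst f (i+1) = (match f i with
      | Option.none => kst f i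
      | Option.some a => ((kst f i).1 * 2 ^ a.1 + 2 * 2 ^ (kst f i).2, (kst f i).2 + a.1)) := rfl
    rw [e]
    unfold rwt
    rcases f i with _ | ⟨l, σ⟩
    · simp
    · simp only
      push_cast
      have hpow : ((1:ℝ)/2)^l * 2 ^ l = 1 := by rw [← mul_pow]; norm_num
      rw [pow_add]
      field_simp
      linear_combination (- 2 * 2 ^ (kst f i).2 : ℝ) * hpow

theorem kst_comp (f : Reqs) (hf : Computable f) : Computable (kst f) := by
  have hpow : Computable₂ (fun a b : ℕ => a ^ b) := primrec_pow.to_comp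
  have hmul : Computable₂ (fun a b : ℕ => a * b) := Primrec.nat_mul.to_comp
  have hadd : Computable₂ (fun a b : ℕ => a + b) := Primrec.nat_add.to_comp
  have := Computable.nat_rec (α := ℕ) (f := fun i => i) (g := fun _ => ((0:ℕ), (0:ℕ)))
    (h := fun _ q => ((f q.1).casesOn q.2 (fun a => (q.2.1 * 2 ^ a.1 + 2 * 2 ^ q.2.2, q.2.2 + a.1)) : ℕ × ℕ))
    Computable.id (Computable.const _) ?_
  · refine this.of_eq fun i => ?_
    unfold kst
    congr 1
    funext i p
    rcases f i with _ | a <;> rfl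
  · apply Computable.option_casesOn (o := fun q : ℕ × (ℕ × (ℕ × ℕ)) => f q.2.1)
      (f := fun q => q.2.2) (g := fun q a => (q.2.2.1 * 2 ^ a.1 + 2 * 2 ^ q.2.2.2, q.2.2.2 + a.1))
    · exact hf.comp (Computable.fst.comp Computable.snd)
    · exact Computable.snd.comp Computable.snd
    · have hq : Computable (fun z : (ℕ × (ℕ × (ℕ × ℕ))) × (ℕ × Str) => z.1.2.2) :=
        Computable.snd.comp (Computable.snd.comp Computable.fst)
      have hl : Computable (fun z : (ℕ × (ℕ × (ℕ × ℕ))) × (ℕ × Str) => z.2.1) :=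
        Computable.fst.comp Computable.snd
      exact Computable.pair
        (hadd.comp (hmul.comp (Computable.fst.comp hq) (hpow.comp (Computable.const 2) hl))
          (hmul.comp (Computable.const 2) (hpow.comp (Computable.const 2) (Computable.snd.comp hq))))
        (hadd.comp (Computable.snd.comp hq) hl)

theorem kG_comp (f : Reqs) (hf : Computable f) : Computable (kG f) := by
  have hpow : Computable₂ (fun a b : ℕ => a ^ b) := primrec_pow.to_comp
  have hmul : Computable₂ (fun a b : ℕ => a * b) := Primrec.nat_mul.to_comp
  have hadd : Computable₂ (fun a b : ℕ => a + b) := Primrec.nat_add.to_comp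
  have hsub : Computable₂ (fun a b : ℕ => a - b) := Primrec.nat_sub.to_comp
  have hdiv : Computable₂ (fun a b : ℕ => a / b) := Primrec.nat_div.to_comp
  have hb : Computable₂ bst := bst_primrec.to_comp
  apply Computable.option_map hf
  have hq : Computable (fun z : ℕ × (ℕ × Str) => kst f z.1) := (kst_comp f hf).comp Computable.fst
  have hl : Computable (fun z : ℕ × (ℕ × Str) => z.2.1) := Computable.fst.comp Computable.snd
  have h2 := hpow.comp (Computable.const 2) (Computable.snd.comp hq)
  exact Computable.pair (Computable.snd.comp (hb.comp hl (hdiv.comp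
    (hsub.comp (hadd.comp (hmul.comp (Computable.fst.comp hq) (hpow.comp (Computable.const 2) hl)) h2)
      (Computable.const 1)) h2))) (Computable.snd.comp Computable.snd)

theorem kcode_spec {f : Reqs} (hs : ∀ N, ∑ j ∈ Finset.range N, rwt f j ≤ 1/2) {i : ℕ} {a : ℕ × Str}
    (ha : f i = Option.some a) :
    (kcode (kst f i) a.1).length = a.1 ∧
    2 * ∑ j ∈ Finset.range i, rwt f j ≤ (val (kcode (kst f i) a.1) : ℝ) / 2 ^ a.1 ∧
    ((val (kcode (kst f i) a.1) : ℝ) + 1) / 2 ^ a.1 ≤ 2 * ∑ j ∈ Finset.range (i+1), rwt f j := by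
  have h1 := hs (i+1)
  have h2 := kst_real f i
  rw [Finset.sum_range_succ] at h1 ⊢
  set x := ∑ j ∈ Finset.range i, rwt f j with hx
  have hr : rwt f i = (1/2)^a.1 := by unfold rwt; rw [ha]
  rw [hr] at h1 ⊢
  generalize kst f i = z at *
  obtain ⟨N, e⟩ := z
  obtain ⟨l, σ⟩ := a
  simp only at *
  unfold kcode
  simp only
  set c := (N * 2 ^ l + 2 ^ e - 1) / 2 ^ e with hc
  have pe : 0 < 2 ^ e := by positivity
  have c1 : N * 2 ^ l ≤ c * 2 ^ e := by
    have := Nat.lt_div_mul_add (a := N * 2 ^ l + 2 ^ e - 1) pe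
    rw [← hc] at this
    omega
  have c2 : c * 2 ^ e < N * 2 ^ l + 2 ^ e := by
    have := Nat.div_mul_le_self (N * 2 ^ l + 2 ^ e - 1) (2 ^ e)
    rw [← hc] at this
    omega
  have c1' : (N:ℝ) * 2 ^ l ≤ c * 2 ^ e := by exact_mod_cast c1
  have c2' : (c:ℝ) * 2 ^ e < N * 2 ^ l + 2 ^ e := by exact_mod_cast c2
  have pe' : (0:ℝ) < 2 ^ e := by positivity
  have pl' : (0:ℝ) < 2 ^ l := by positivity
  have hN : (N:ℝ) = 2 * x * 2 ^ e := by rw [← h2]; field_simp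
  rw [hN] at c1' c2'
  have d1 : 2 * x * 2 ^ l ≤ c := by
    by_contra h
    push Not at h
    nlinarith
  have d2 : (c:ℝ) < 2 * x * 2 ^ l + 1 := by
    by_contra h
    push Not at h
    nlinarith
  have hpow : ((1:ℝ)/2)^l * 2 ^ l = 1 := by rw [← mul_pow]; norm_num
  have d3 : (c:ℝ) < 2 ^ l := by nlinarith
  have d4 : c < 2 ^ l := by exact_mod_cast d3
  rw [bst_val d4]
  refine ⟨(bst_spec l c).1, ?_, ?_⟩
  · rw [le_div_iff₀ pl']; exact d1
  · rw [div_le_iff₀ pl']; nlinarith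

theorem rwt_nonneg (f : Reqs) (i : ℕ) : 0 ≤ rwt f i := by
  unfold rwt; rcases f i with _ | a <;> simp

theorem kG_inc {f : Reqs} (hs : ∀ N, ∑ j ∈ Finset.range N, rwt f j ≤ 1/2) {i j : ℕ} (hij : i ≠ j)
    {a b : Str × Str} (ha : kG f i = Option.some a) (hb : kG f j = Option.some b) : ¬ a.1 <+: b.1 := by
  unfold kG at ha hb
  rw [Option.map_eq_some_iff] at ha hb
  obtain ⟨⟨l, σ⟩, ha, rfl⟩ := ha
  obtain ⟨⟨l', σ'⟩, hb, rfl⟩ := hb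
  obtain ⟨a1, a2, a3⟩ := kcode_spec hs ha
  obtain ⟨b1, b2, b3⟩ := kcode_spec hs hb
  simp only at *
  rintro ⟨t, ht⟩
  set ρ := kcode (kst f i) l
  set ρ' := kcode (kst f j) l'
  have hv := val_append ρ t
  have hl : l' = l + t.length := by rw [← b1, ← ht, List.length_append, a1]
  have hvt := val_lt t
  rw [ht] at hv
  have hv' : (val ρ' : ℝ) = val ρ * 2 ^ t.length + val t := by exact_mod_cast hv
  have hvt' : (val t : ℝ) < 2 ^ t.length := by exact_mod_cast hvt
  have mono : ∀ m n, m ≤ n → ∑ j ∈ Finset.range m, rwt f j ≤ ∑ j ∈ Finset.range n, rwt f j := by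
    intro m n h
    apply Finset.sum_le_sum_of_subset_of_nonneg
    · intro x hx; rw [Finset.mem_range] at *; omega
    · intro x _ _; exact rwt_nonneg f x
  have pl : (0:ℝ) < 2 ^ l := by positivity
  have pt : (0:ℝ) < 2 ^ t.length := by positivity
  have e1 : (val ρ : ℝ) / 2 ^ l ≤ val ρ' / 2 ^ l' := by
    rw [hl, pow_add, div_le_div_iff₀ pl (by positivity), hv']
    have : (0:ℝ) ≤ val t := by positivity
    nlinarith
  have e2 : (val ρ' : ℝ) / 2 ^ l' < (val ρ + 1) / 2 ^ l := by
    rw [hl, pow_add, div_lt_div_iff₀ (by positivity) pl, hv']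
    nlinarith
  rcases lt_or_gt_of_ne hij with h | h
  · have := mono (i+1) j h
    linarith
  · have := mono (j+1) i h
    have e3 : (val ρ' : ℝ) / 2 ^ l' < (val ρ' + 1) / 2 ^ l' := by
      apply div_lt_div_of_pos_right _ (by positivity)
      linarith
    linarith

theorem pf_of_graph (G : ℕ → Option (Str × Str)) (hG : Computable G)
    (hinc : ∀ i j a b, G i = Option.some a → G j = Option.some b → a.1 <+: b.1 → a = b) :
    ∃ M : Str →. Str, PFMachine M ∧ ∀ i a, G i = Option.some a → a.2 ∈ M a.1 := by
  let F : Str → ℕ → Option Str := fun ρ i => (G i).bind fun a => if a.1 = ρ then Option.some a.2 else Option.none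
  have hF : Computable₂ F := by
    have h1 : Computable (fun z : Str × ℕ => G z.2) := hG.comp Computable.snd
    apply Computable.option_bind h1
    have hdec : Computable (fun w : (Str × ℕ) × (Str × Str) => decide (w.2.1 = w.1.1)) := by
      have h : PrimrecRel (fun a b : Str => a = b) := Primrec.eq
      have := (h.comp (Primrec.fst.comp Primrec.snd) (Primrec.fst.comp Primrec.fst) :
        PrimrecPred (fun w : (Str × ℕ) × (Str × Str) => w.2.1 = w.1.1)).decide.to_comp
      exact this.of_eq fun _ => by congr
    have h3 : Computable (fun w : (Str × ℕ) × (Str × Str) => Option.some w.2.2) :=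
      Computable.option_some.comp (Computable.snd.comp Computable.snd)
    refine (Computable.cond hdec h3 (Computable.const Option.none)).of_eq fun w => ?_
    by_cases h : w.2.1 = w.1.1 <;> simp [h]
  have hmem : ∀ ρ i x, x ∈ F ρ i ↔ G i = Option.some (ρ, x) := by
    intro ρ i x
    simp only [F, Option.mem_def, Option.bind_eq_some_iff]
    constructor
    · rintro ⟨a, h1, h2⟩
      split_ifs at h2 with h
      rw [h1, ← h, ← Option.some.inj h2]
    · intro h; exact ⟨_, h, by simp⟩
  have hMmem : ∀ ρ x, x ∈ Nat.rfindOpt (F ρ) → ∃ i, G i = Option.some (ρ, x) := by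
    intro ρ x hx
    obtain ⟨i, hi⟩ := Nat.rfindOpt_spec hx
    exact ⟨i, (hmem _ _ _).1 hi⟩
  refine ⟨fun ρ => Nat.rfindOpt (F ρ), ⟨Partrec.rfindOpt hF, ?_⟩, ?_⟩
  · intro ρ₁ ρ₂ h1 h2 hp
    obtain ⟨i, hi⟩ := hMmem _ _ (Part.get_mem h1)
    obtain ⟨j, hj⟩ := hMmem _ _ (Part.get_mem h2)
    have := hinc i j _ _ hi hj hp
    exact congrArg Prod.fst this
  · intro i a hi
    have hd : (Nat.rfindOpt (F a.1)).Dom := by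
      rw [Nat.rfindOpt_dom]
      exact ⟨i, a.2, (hmem _ _ _).2 hi⟩
    obtain ⟨j, hj⟩ := hMmem _ _ (Part.get_mem hd)
    have := hinc i j _ _ hi hj (List.prefix_refl _)
    have h2 : a.2 = (Nat.rfindOpt (F a.1)).get hd := congrArg Prod.snd this
    rw [h2]; exact Part.get_mem hd

theorem KC_le {M : Str →. Str} {σ ρ : Str} (h : σ ∈ M ρ) : KC M σ ≤ (ρ.length : ℕ∞) :=
  iInf_le (fun ρ : {ρ : Str // σ ∈ M ρ} => ((ρ : Str).length : ℕ∞)) ⟨ρ, h⟩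

theorem KC_attain {M : Str →. Str} {σ : Str} (h : KC M σ ≠ ⊤) : ∃ ρ, σ ∈ M ρ ∧ KC M σ = (ρ.length : ℕ∞) := by
  unfold KC at *
  have hne : Nonempty {ρ : Str // σ ∈ M ρ} := by
    by_contra hcon
    rw [not_nonempty_iff] at hcon
    exact h (by simp)
  obtain ⟨⟨ρ, hρ⟩, h2⟩ := ENat.exists_eq_iInf (fun ρ : {ρ : Str // σ ∈ M ρ} => ((ρ : Str).length : ℕ∞))
  exact ⟨ρ, hρ, h2.symm⟩

theorem KC_ne_top {U : Str →. Str} (hU : OptimalPF U) (σ : Str) : KC U σ ≠ ⊤ := by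
  obtain ⟨M, hM, h2⟩ := pf_of_graph (fun _ => Option.some ([], σ)) (Computable.const _)
    (by rintro i j a b h1 h2 -; rw [h1] at h2; exact Option.some.inj h2)
  obtain ⟨c, hc⟩ := hU.2 M hM
  have h3 := KC_le (h2 0 _ rfl)
  have h4 : KC U σ ≤ ((0 + c : ℕ) : ℕ∞) := by
    refine (hc σ).trans ?_
    push_cast
    gcongr
    simpa using h3
  exact ne_top_of_le_ne_top (ENat.natCast_ne_top _) h4

namespace Sys
variable (Y : Sys)

/-! ### Primitive recursiveness of the stack -/

def NLP : Prop := Primrec (fun z : (ℕ × ℕ × ℕ) × ℕ × ℕ => Y.nl z.1.1 z.1.2.1 z.1.2.2 z.2.1 z.2.2)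

theorem h1_primrec (hch : Primrec₂ Y.ch) : Primrec (fun z : ℕ × ℕ × ℕ => Y.h1 z.1 z.2.1 z.2.2) := by
  have := Primrec.cond (hch.comp Primrec.fst (Primrec.fst.comp Primrec.snd))
    (Primrec.succ.comp (Primrec.fst.comp Primrec.snd)) 
    (Primrec.snd.comp Primrec.snd : Primrec (fun z : ℕ × ℕ × ℕ => z.2.2))
  refine this.of_eq fun z => ?_
  unfold Sys.h1
  cases Y.ch z.1 z.2.1 <;> simp

/-- state of the left to right scan: `(done, (e, g), output reversed)` -/
abbrev Scan := Bool × (ℕ × ℕ) × List (ℕ × ℕ)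

def halts (s e g d h : ℕ) : Bool :=
  Y.ch s d || decide (Y.nl s e g d (Y.h1 s d h) < Y.h1 s d h)

def scanStep (s : ℕ) (q : Scan) (a : ℕ × ℕ) : Scan :=
  bif q.1 then q else
  bif Y.halts s q.2.1.1 q.2.1.2 a.1 a.2 then
    (true, q.2.1, (s+1, s+2) :: (a.1, Y.nl s q.2.1.1 q.2.1.2 a.1 (Y.h1 s a.1 a.2)) :: q.2.2)
  else (false, a, a :: q.2.2)

def scanOut (s : ℕ) (q : Scan) : List (ℕ × ℕ) :=
  (bif q.1 then q.2.2 else (s+1, s+2) :: q.2.2).reverse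

theorem scan_done (s : ℕ) : ∀ (L : List (ℕ × ℕ)) (q : Scan), q.1 = true →
    L.foldl (Y.scanStep s) q = q := by
  intro L
  induction L with
  | nil => intro q _; rfl
  | cons a L ih =>
    intro q hq
    have : Y.scanStep s q a = q := by unfold scanStep; rw [hq]; rfl
    rw [List.foldl_cons, this, ih q hq]

theorem scan_proc (s : ℕ) : ∀ (L : List (ℕ × ℕ)) (e g : ℕ) (acc : List (ℕ × ℕ)),
    scanOut s (L.foldl (Y.scanStep s) (false, (e, g), acc)) = acc.reverse ++ Y.proc s e g L := by
  intro L
  induction L with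
  | nil => intro e g acc; simp [scanOut, proc]
  | cons a L ih =>
    obtain ⟨d, h⟩ := a
    intro e g acc
    rw [List.foldl_cons]
    unfold scanStep
    simp only [cond_false]
    unfold proc
    by_cases hc : Y.halts s e g d h = true
    · rw [hc, cond_true]
      have := Y.scan_done s L (true, (e, g), (s + 1, s + 2) :: (d, Y.nl s e g d (Y.h1 s d h)) :: acc) rfl
      unfold scanStep at this
      rw [this, if_pos]
      · simp [scanOut]
      · simpa [halts] using hc
    · have hc' : Y.halts s e g d h = false := by simpa using hc
      rw [hc', cond_false]
      have := ih d h ((d,h)::acc)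
      unfold scanStep at this
      rw [this, if_neg]
      · simp
      · simpa [halts] using hc

theorem nl_comp (hch : Primrec₂ Y.ch) (hnl : Y.NLP) {α : Type} [Primcodable α] {s e g d h : α → ℕ}
    (hs : Primrec s) (he : Primrec e) (hg : Primrec g) (hd : Primrec d) (hh : Primrec h) :
    Primrec (fun x => Y.nl (s x) (e x) (g x) (d x) (Y.h1 (s x) (d x) (h x))) := by
  have h1 := (Y.h1_primrec hch).comp (Primrec.pair hs (Primrec.pair hd hh))
  exact Primrec.comp hnl (Primrec.pair (Primrec.pair hs (Primrec.pair he hg)) (Primrec.pair hd h1))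

theorem stop_comp (hch : Primrec₂ Y.ch) (hnl : Y.NLP) {α : Type} [Primcodable α] {s e g d h : α → ℕ}
    (hs : Primrec s) (he : Primrec e) (hg : Primrec g) (hd : Primrec d) (hh : Primrec h) :
    Primrec (fun x => Y.halts (s x) (e x) (g x) (d x) (h x)) := by
  have h1 := (Y.h1_primrec hch).comp (Primrec.pair hs (Primrec.pair hd hh))
  have h2 := Y.nl_comp hch hnl hs he hg hd hh
  have h3 := (Primrec.nat_lt.comp h2 h1).decide
  exact Primrec.or.comp (hch.comp hs hd) (h3.of_eq fun _ => by congr)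

theorem scanStep_primrec (hch : Primrec₂ Y.ch) (hnl : Y.NLP) :
    Primrec (fun z : ℕ × Scan × (ℕ × ℕ) => Y.scanStep z.1 z.2.1 z.2.2) := by
  have hs : Primrec (fun z : ℕ × Scan × (ℕ × ℕ) => z.1) := Primrec.fst
  have hq : Primrec (fun z : ℕ × Scan × (ℕ × ℕ) => z.2.1) := Primrec.fst.comp Primrec.snd
  have ha : Primrec (fun z : ℕ × Scan × (ℕ × ℕ) => z.2.2) := Primrec.snd.comp Primrec.snd
  have heg := Primrec.fst.comp (Primrec.snd.comp hq)
  have hacc := Primrec.snd.comp (Primrec.snd.comp hq)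
  have he := Primrec.fst.comp heg
  have hg := Primrec.snd.comp heg
  have hd := Primrec.fst.comp ha
  have hh := Primrec.snd.comp ha
  have hn := Y.nl_comp hch hnl hs he hg hd hh
  have hst := Y.stop_comp hch hnl hs he hg hd hh
  have htop : Primrec (fun z : ℕ × Scan × (ℕ × ℕ) => (z.1+1, z.1+2)) :=
    Primrec.pair (Primrec.succ.comp hs) (Primrec.succ.comp (Primrec.succ.comp hs))
  exact Primrec.cond (Primrec.fst.comp hq) hq
    (Primrec.cond hst
      (Primrec.pair (Primrec.const true) (Primrec.pair heg
        (Primrec.list_cons.comp htop (Primrec.list_cons.comp (Primrec.pair hd hn) hacc))))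
      (Primrec.pair (Primrec.const false) (Primrec.pair ha (Primrec.list_cons.comp ha hacc))))

theorem st_primrec (hch : Primrec₂ Y.ch) (hnl : Y.NLP) : Primrec Y.st := by
  have hproc : Primrec₂ (fun (s : ℕ) (L : List (ℕ × ℕ)) => Y.proc s 0 0 L) := by
    have hs : Primrec (fun z : ℕ × List (ℕ × ℕ) => z.1) := Primrec.fst
    have hf : Primrec (fun z : ℕ × List (ℕ × ℕ) => z.2.foldl (Y.scanStep z.1) (false, (0, 0), [])) := by
      apply Primrec.list_foldl (f := fun z : ℕ × List (ℕ × ℕ) => z.2)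
        (g := fun _ => ((false, (0, 0), []) : Scan)) (h := fun z p => Y.scanStep z.1 p.1 p.2)
      · exact Primrec.snd
      · exact Primrec.const _
      · exact (Y.scanStep_primrec hch hnl).comp
          (Primrec.pair (Primrec.fst.comp Primrec.fst)
            (Primrec.pair (Primrec.fst.comp Primrec.snd) (Primrec.snd.comp Primrec.snd)))
    have hacc := Primrec.snd.comp (Primrec.snd.comp hf)
    have htop : Primrec (fun z : ℕ × List (ℕ × ℕ) => (z.1+1, z.1+2)) :=
      Primrec.pair (Primrec.succ.comp hs) (Primrec.succ.comp (Primrec.succ.comp hs))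
    have := Primrec.list_reverse.comp (Primrec.cond (Primrec.fst.comp hf) hacc
      (Primrec.list_cons.comp htop hacc))
    refine Primrec.of_eq this fun z => ?_
    have := Y.scan_proc z.1 z.2 0 0 []
    simpa [scanOut] using this
  have := Primrec.nat_rec₁ (f := fun s L => Y.proc s 0 0 L) [(0, 1)] hproc
  refine this.of_eq fun n => ?_
  induction n with
  | zero => rfl
  | succ n ih => simp only [st, ← ih]

theorem pos_primrec : Primrec₂ (fun (k : ℕ) (L : List (ℕ × ℕ)) => pos k L) := by
  have : Primrec (fun z : ℕ × List (ℕ × ℕ) => z.2.foldr (fun a r => if z.1 < a.2 then a.1 + 1 else r) 0) := by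
    apply Primrec.list_foldr (f := fun z : ℕ × List (ℕ × ℕ) => z.2) (g := fun _ => 0)
      (h := fun z p => if z.1 < p.1.2 then p.1.1 + 1 else p.2)
    · exact Primrec.snd
    · exact Primrec.const _
    · have ha : Primrec (fun w : (ℕ × List (ℕ × ℕ)) × ((ℕ × ℕ) × ℕ) => w.2.1) :=
        Primrec.fst.comp Primrec.snd
      exact Primrec.ite (Primrec.nat_lt.comp (Primrec.fst.comp Primrec.fst) (Primrec.snd.comp ha))
        (Primrec.succ.comp (Primrec.fst.comp ha)) (Primrec.snd.comp Primrec.snd)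
  refine this.of_eq fun z => ?_
  obtain ⟨k, L⟩ := z
  simp only
  induction L with
  | nil => rfl
  | cons a L ih => simp only [List.foldr_cons, ih, pos]

/-- state for the event scan : `(done, (e, g), result)` -/
abbrev EScan := Bool × (ℕ × ℕ) × Option (ℕ × ℕ)

def evc (k s e g d h : ℕ) : Bool :=
  decide (Y.nl s e g d (Y.h1 s d h) ≤ k) && decide (k < Y.h1 s d h)

def evStep (k s : ℕ) (q : EScan) (a : ℕ × ℕ) : EScan :=
  bif q.1 then q else
  bif Y.evc k s q.2.1.1 q.2.1.2 a.1 a.2 then (true, q.2.1, Option.some (q.2.1.1, a.1)) else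
  bif Y.halts s q.2.1.1 q.2.1.2 a.1 a.2 then (true, q.2.1, Option.none)
  else (false, a, Option.none)

theorem evScan_done (k s : ℕ) : ∀ (L : List (ℕ × ℕ)) (q : EScan), q.1 = true →
    L.foldl (Y.evStep k s) q = q := by
  intro L
  induction L with
  | nil => intro q _; rfl
  | cons a L ih =>
    intro q hq
    have : Y.evStep k s q a = q := by unfold evStep; rw [hq]; rfl
    rw [List.foldl_cons, this, ih q hq]

theorem evScan_ev (k s : ℕ) : ∀ (L : List (ℕ × ℕ)) (e g : ℕ),
    (L.foldl (Y.evStep k s) (false, (e, g), Option.none)).2.2 = Y.ev k s e g L := by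
  intro L
  induction L with
  | nil => intro e g; simp [ev]
  | cons a L ih =>
    obtain ⟨d, h⟩ := a
    intro e g
    rw [List.foldl_cons]
    unfold ev
    by_cases h1 : Y.evc k s e g d h = true
    · have : Y.evStep k s (false, (e, g), Option.none) (d, h) = (true, (e, g), Option.some (e, d)) := by
        unfold evStep; simp [h1]
      rw [this, Y.evScan_done _ _ _ _ rfl, if_pos (by simpa [evc] using h1)]
    · have h1' : Y.evc k s e g d h = false := by simpa using h1
      rw [if_neg (by simpa [evc] using h1)]
      by_cases hc : Y.halts s e g d h = true
      · have : Y.evStep k s (false, (e, g), Option.none) (d, h) = (true, (e, g), Option.none) := by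
          unfold evStep; simp [h1', hc]
        rw [this, Y.evScan_done _ _ _ _ rfl, if_pos (by simpa [halts] using hc)]
      · have hc' : Y.halts s e g d h = false := by simpa using hc
        have : Y.evStep k s (false, (e, g), Option.none) (d, h) = (false, (d, h), Option.none) := by
          unfold evStep; simp [h1', hc']
        rw [this, ih d h, if_neg (by simpa [halts] using hc)]

theorem ev_primrec (hch : Primrec₂ Y.ch) (hnl : Y.NLP) (k : ℕ) :
    Primrec (fun t => Y.ev k t 0 0 (Y.st t)) := by
  have hstep : Primrec (fun z : ℕ × EScan × (ℕ × ℕ) => Y.evStep k z.1 z.2.1 z.2.2) := by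
    have hs : Primrec (fun z : ℕ × EScan × (ℕ × ℕ) => z.1) := Primrec.fst
    have hq : Primrec (fun z : ℕ × EScan × (ℕ × ℕ) => z.2.1) := Primrec.fst.comp Primrec.snd
    have ha : Primrec (fun z : ℕ × EScan × (ℕ × ℕ) => z.2.2) := Primrec.snd.comp Primrec.snd
    have heg := Primrec.fst.comp (Primrec.snd.comp hq)
    have he := Primrec.fst.comp heg
    have hg := Primrec.snd.comp heg
    have hd := Primrec.fst.comp ha
    have hh := Primrec.snd.comp ha
    have hn := Y.nl_comp hch hnl hs he hg hd hh
    have h1 := (Y.h1_primrec hch).comp (Primrec.pair hs (Primrec.pair hd hh))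
    have hst := Y.stop_comp hch hnl hs he hg hd hh
    have hc1 := (Primrec.nat_le.comp hn (Primrec.const k)).decide
    have hc2 := (Primrec.nat_lt.comp (Primrec.const k) h1).decide
    have hev : Primrec (fun z : ℕ × EScan × (ℕ × ℕ) =>
        Y.evc k z.1 z.2.1.2.1.1 z.2.1.2.1.2 z.2.2.1 z.2.2.2) :=
      (Primrec.and.comp hc1 hc2).of_eq fun _ => by unfold evc; congr
    exact Primrec.cond (Primrec.fst.comp hq) hq
      (Primrec.cond hev
        (Primrec.pair (Primrec.const true) (Primrec.pair heg
          (Primrec.option_some.comp (Primrec.pair he hd))))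
        (Primrec.cond hst
          (Primrec.pair (Primrec.const true) (Primrec.pair heg (Primrec.const Option.none)))
          (Primrec.pair (Primrec.const false) (Primrec.pair ha (Primrec.const Option.none)))))
  have hf : Primrec (fun t : ℕ => (Y.st t).foldl (Y.evStep k t) (false, (0, 0), Option.none)) := by
    apply Primrec.list_foldl (f := fun t : ℕ => Y.st t)
      (g := fun _ => ((false, (0, 0), Option.none) : EScan)) (h := fun z p => Y.evStep k z p.1 p.2)
    · exact Y.st_primrec hch hnl
    · exact Primrec.const _
    · exact hstep.comp
        (Primrec.pair Primrec.fst
          (Primrec.pair (Primrec.fst.comp Primrec.snd) (Primrec.snd.comp Primrec.snd)))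
  exact (Primrec.snd.comp (Primrec.snd.comp hf)).of_eq fun t => Y.evScan_ev k t _ 0 0

end Sys

section Concrete
open Nat.Partrec (Code)

/-! ### Concrete data -/

theorem kraft_str (S : Finset Str) (h : ∀ a ∈ S, ∀ b ∈ S, a <+: b → a = b) :
    ∑ w ∈ S, ((1:ℝ)/2)^w.length ≤ 1 := by
  by_cases h0 : [] ∈ S
  · have : S = {[]} := by
      ext b
      rw [Finset.mem_singleton]
      exact ⟨fun hb => (h [] h0 b hb ⟨b, rfl⟩).symm, fun hb => hb ▸ h0⟩
    rw [this]; simp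
  · have hud : InformationTheory.UniquelyDecodable (S : Set Str) := by
      intro L1
      induction L1 with
      | nil =>
        intro L2 _ h2 hf
        cases L2 with
        | nil => rfl
        | cons b L2 =>
          have hb := h2 b (by simp)
          simp only [List.flatten_nil, List.flatten_cons] at hf
          have : b = [] := (List.append_eq_nil_iff.1 hf.symm).1
          rw [this] at hb; exact absurd hb h0
      | cons a L1 ih =>
        intro L2 h1 h2 hf
        have ha := h1 a (by simp)
        cases L2 with
        | nil =>
          simp only [List.flatten_nil, List.flatten_cons] at hf
          have : a = [] := (List.append_eq_nil_iff.1 hf).1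
          rw [this] at ha; exact absurd ha h0
        | cons b L2 =>
          have hb := h2 b (by simp)
          simp only [List.flatten_cons] at hf
          have hab : a = b := by
            have p1 : a <+: b ++ L2.flatten := ⟨_, hf⟩
            have p2 : b <+: b ++ L2.flatten := ⟨_, rfl⟩
            rcases pre_total p1 p2 with h' | h'
            · exact h a ha b hb h'
            · exact (h b hb a ha h').symm
          subst hab
          rw [ih L2 (fun w hw => h1 w (by simp [hw])) (fun w hw => h2 w (by simp [hw]))
            (List.append_cancel_left hf)]
    have := InformationTheory.kraft_mcmillan_inequality hud
    simpa using this

def Ast (cA : Code) (s n : ℕ) : Bool := (Code.evaln s cA n).isSome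

def rs (cA : Code) (s n : ℕ) : Str := (List.range n).map (Ast cA s)

def pg (p : ℕ) : Option Str :=
  (Encodable.decode p : Option Str).bind fun ρ =>
    bif decide (Encodable.encode ρ = p) then Option.some ρ else Option.none

theorem pg_iff {p : ℕ} {ρ : Str} : pg p = Option.some ρ ↔ Encodable.encode ρ = p := by
  unfold pg
  rw [Option.bind_eq_some_iff]
  constructor
  · rintro ⟨a, _, h⟩
    by_cases hc : Encodable.encode a = p
    · simp only [hc, decide_true, cond_true, Option.some.injEq] at h
      rw [← h]; exact hc
    · simp [hc] at h
  · intro h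
    exact ⟨ρ, by rw [← h, Encodable.encodek], by simp [h]⟩

def len (p : ℕ) : ℕ := ((pg p).map List.length).getD 0

def uu (cU : Code) (p s : ℕ) : Option Str :=
  (pg p).bind fun _ => (Code.evaln s cU p).bind fun v => (Encodable.decode v : Option Str).bind fun σ =>
    bif decide (σ.length < s) then Option.some σ else Option.none

theorem uu_iff {cU : Code} {p s : ℕ} {σ : Str} : uu cU p s = Option.some σ ↔
    (∃ ρ, pg p = Option.some ρ) ∧ (∃ v, v ∈ Code.evaln s cU p ∧ 
      (Encodable.decode v : Option Str) = Option.some σ) ∧ σ.length < s := by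
  unfold uu
  simp only [Option.bind_eq_some_iff, Option.mem_def]
  constructor
  · rintro ⟨ρ, h1, v, h2, σ', h3, h4⟩
    by_cases hc : σ'.length < s
    · simp only [hc, decide_true, cond_true, Option.some.injEq] at h4
      subst h4
      exact ⟨⟨ρ, h1⟩, ⟨v, h2, h3⟩, hc⟩
    · simp [hc] at h4
  · rintro ⟨⟨ρ, h1⟩, ⟨v, h2, h3⟩, hc⟩
    exact ⟨ρ, h1, v, h2, σ, h3, by simp [hc]⟩

theorem uu_mono {cU : Code} {p s t : ℕ} {σ : Str} (h : s ≤ t) (hs : uu cU p s = Option.some σ) :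
    uu cU p t = Option.some σ := by
  rw [uu_iff] at *
  obtain ⟨h1, ⟨v, h2, h3⟩, h4⟩ := hs
  exact ⟨h1, ⟨v, Code.evaln_mono h h2, h3⟩, by omega⟩

theorem uu_lt {cU : Code} {p s : ℕ} {σ : Str} (hs : uu cU p s = Option.some σ) : p < s := by
  rw [uu_iff] at hs
  obtain ⟨h1, ⟨v, h2, h3⟩, h4⟩ := hs
  exact Code.evaln_bound h2

theorem uu_uniq {cU : Code} {p s t : ℕ} {σ τ : Str} (hs : uu cU p s = Option.some σ)
    (ht : uu cU p t = Option.some τ) : σ = τ := by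
  have h1 := uu_mono (le_max_left s t) hs
  have h2 := uu_mono (le_max_right s t) ht
  rw [h1] at h2; exact Option.some.inj h2

theorem len_lt {cU : Code} {p s : ℕ} {σ : Str} (hs : uu cU p s = Option.some σ) : len p < s := by
  have := uu_lt hs
  rw [uu_iff] at hs
  obtain ⟨ρ, hρ⟩ := hs.1
  have h2 : len p = ρ.length := by unfold len; rw [hρ]; rfl
  have h3 := Encodable.length_le_encode ρ
  rw [pg_iff] at hρ
  have h4 : ρ.length ≤ p := by rw [← hρ]; exact h3
  omega

noncomputable def uuInf (cU : Code) (p : ℕ) : Str :=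
  if h : ∃ s σ, uu cU p s = Option.some σ then h.choose_spec.choose else []

theorem uuInf_eq {cU : Code} {p s : ℕ} {σ : Str} (hs : uu cU p s = Option.some σ) : uuInf cU p = σ := by
  have h : ∃ s σ, uu cU p s = Option.some σ := ⟨s, σ, hs⟩
  unfold uuInf
  rw [dif_pos h]
  exact uu_uniq h.choose_spec.choose_spec hs

def cborn (cU : Code) (p s : ℕ) : Bool := (uu cU p s).isSome

def cal (cA cU : Code) (p s : ℕ) : Bool :=
  ((uu cU p s).map fun σ => decide (σ = rs cA s σ.length)).getD false

theorem cborn_iff {cU : Code} {p s : ℕ} : cborn cU p s = true ↔ ∃ σ, uu cU p s = Option.some σ := by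
  unfold cborn; rw [Option.isSome_iff_exists]

theorem cal_iff {cA cU : Code} {p s : ℕ} : cal cA cU p s = true ↔ 
    uu cU p s = Option.some (rs cA s (uuInf cU p).length) := by
  unfold cal
  rcases h : uu cU p s with _ | σ
  · simp
  · have := uuInf_eq h
    simp [this]

def cch (cA : Code) (s d : ℕ) : Bool := !decide (rs cA (s+1) d = rs cA s d)

theorem rs_eq_iff {cA : Code} {s t n : ℕ} : rs cA s n = rs cA t n ↔ ∀ i < n, Ast cA s i = Ast cA t i := by
  unfold rs
  rw [List.map_inj_left]
  simp

theorem rs_length (cA : Code) (s n : ℕ) : (rs cA s n).length = n := by simp [rs]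

theorem Ast_mono {cA : Code} {s t n : ℕ} (h : s ≤ t) (hs : Ast cA s n = true) : Ast cA t n = true := by
  unfold Ast at *
  rw [Option.isSome_iff_exists] at *
  obtain ⟨v, hv⟩ := hs
  exact ⟨v, Code.evaln_mono h hv⟩

theorem cch_iff {cA : Code} {s d : ℕ} : cch cA s d = true ↔ 
    ∃ i < d, Ast cA s i = false ∧ Ast cA (s+1) i = true := by
  unfold cch
  simp only [Bool.not_eq_true', decide_eq_false_iff_not, rs_eq_iff, not_forall]
  constructor
  · rintro ⟨i, hi, hne⟩
    refine ⟨i, hi, ?_⟩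
    rcases h1 : Ast cA s i
    · rw [h1] at hne
      exact ⟨rfl, by simpa using hne⟩
    · rw [h1, Ast_mono (Nat.le_succ s) h1] at hne
      exact absurd rfl hne
  · rintro ⟨i, hi, h1, h2⟩
    exact ⟨i, hi, by rw [h1, h2]; decide⟩

def On (cU : Code) (s : ℕ) : ℕ :=
  ∑ p ∈ Finset.range s, bif cborn cU p s then 2 ^ (s - len p) else 0

def nnS (cU : Code) (p s : ℕ) : ℕ := ((uu cU p s).map List.length).getD 0

def Wn (cA cU : Code) (s d : ℕ) : ℕ :=
  ∑ p ∈ Finset.range s, bif cal cA cU p s && decide (d ≤ nnS cU p s) then 2 ^ (s - len p) else 0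

def nlt (cA cU : Code) (s e g d h : ℕ) : Bool :=
  decide (h ≤ g) || decide (8 ^ h * Wn cA cU (s+1) d + 2 ^ (s+1-e) * On cU e ≤ On cU (s+1))

def cnl (cA cU : Code) (s e g d h : ℕ) : ℕ :=
  Nat.findGreatest (fun h => nlt cA cU s e g d h = true) h

theorem ch_fin_aux (cA : Code) (d : ℕ) : ∃ s0, ∀ s, s0 ≤ s → cch cA s d = false := by
  have key : ∀ i, ∃ s0, ∀ s, s0 ≤ s → Ast cA s i = Ast cA s0 i := by
    intro i
    by_cases h : ∃ s, Ast cA s i = true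
    · obtain ⟨s, hs⟩ := h
      exact ⟨s, fun t ht => by rw [Ast_mono ht hs, hs]⟩
    · push Not at h
      exact ⟨0, fun t _ => by
        have h1 : Ast cA t i = false := by simpa using h t
        have h2 : Ast cA 0 i = false := by simpa using h 0
        rw [h1, h2]⟩
  choose f hf using key
  refine ⟨(Finset.range d).sup f, fun s hs => ?_⟩
  by_contra hc
  rw [Bool.not_eq_false, cch_iff] at hc
  obtain ⟨i, hi, h1, h2⟩ := hc
  have : f i ≤ (Finset.range d).sup f := Finset.le_sup (Finset.mem_range.2 hi)
  rw [hf i s (by omega)] at h1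
  rw [hf i (s+1) (by omega), h1] at h2
  exact absurd h2 (by decide)

/-- `cU` computes `U` on codes -/
def Computes (cU : Code) (U : Str →. Str) : Prop :=
  Code.eval cU = fun n => Part.bind (Encodable.decode (α := Str) n) fun a => (U a).map Encodable.encode

theorem uu_sound {cU : Code} {U : Str →. Str} (hc : Computes cU U) {p s : ℕ} {σ : Str}
    (h : uu cU p s = Option.some σ) : ∃ ρ, Encodable.encode ρ = p ∧ ρ.length = len p ∧ σ ∈ U ρ := by
  rw [uu_iff] at h
  obtain ⟨⟨ρ, hρ⟩, ⟨v, hv, hd⟩, _⟩ := h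
  have h2 := Code.evaln_sound hv
  have h3 : len p = ρ.length := by unfold len; rw [hρ]; rfl
  have h4 := pg_iff.1 hρ
  refine ⟨ρ, h4, h3.symm, ?_⟩
  rw [hc, ← h4] at h2
  simp only [Encodable.encodek, Part.coe_some, Part.bind_some, Part.mem_map_iff] at h2
  obtain ⟨a, ha, rfl⟩ := h2
  rw [Encodable.encodek] at hd
  rw [← Option.some.inj hd]; exact ha

theorem uu_complete {cU : Code} {U : Str →. Str} (hc : Computes cU U) {ρ σ : Str} (h : σ ∈ U ρ) :
    ∃ s, uu cU (Encodable.encode ρ) s = Option.some σ := by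
  have h1 : Encodable.encode σ ∈ Code.eval cU (Encodable.encode ρ) := by
    rw [hc]
    simp only [Encodable.encodek, Part.coe_some, Part.bind_some, Part.mem_map_iff]
    exact ⟨σ, h, rfl⟩
  obtain ⟨k, hk⟩ := Code.evaln_complete.1 h1
  refine ⟨max k (σ.length + 1), ?_⟩
  rw [uu_iff]
  exact ⟨⟨ρ, pg_iff.2 rfl⟩, ⟨_, Code.evaln_mono (le_max_left _ _) hk, Encodable.encodek _⟩, by
    have := le_max_right k (σ.length+1); omega⟩

theorem len_encode (ρ : Str) : len (Encodable.encode ρ) = ρ.length := by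
  unfold len; rw [pg_iff.2 rfl]; rfl

noncomputable def mkSys0 (cA cU : Code) (U : Str →. Str) (hU : PFMachine U) (hc : Computes cU U) : Sys0 where
  al := cal cA cU
  born := cborn cU
  nn := fun p => (uuInf cU p).length
  wt := fun p => (1/2)^len p
  ch := cch cA
  al_lt := fun p s h => uu_lt (cal_iff.1 h)
  al_nn := fun p s h => by
    have := (uu_iff.1 (cal_iff.1 h)).2.2
    rwa [rs_length] at this
  al_born := fun p s h => cborn_iff.2 ⟨_, cal_iff.1 h⟩
  born_lt := fun p s h => by obtain ⟨σ, hσ⟩ := cborn_iff.1 h; exact uu_lt hσ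
  born_mono := fun p s t hst h => by
    obtain ⟨σ, hσ⟩ := cborn_iff.1 h
    exact cborn_iff.2 ⟨σ, uu_mono hst hσ⟩
  al_step := fun p s h hch => by
    rw [cal_iff] at *
    rw [uu_mono (Nat.le_succ s) h]
    have : rs cA (s+1) (uuInf cU p).length = rs cA s (uuInf cU p).length := by
      unfold cch at hch
      simpa using hch
    rw [this]
  al_dead := fun p r s t h hrs hch hst => by
    by_contra hcon
    rw [Bool.not_eq_false, cal_iff] at hcon
    rw [cal_iff] at h
    have := uu_uniq h hcon
    rw [rs_eq_iff] at this
    rw [cch_iff] at hch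
    obtain ⟨i, hi, h1, h2⟩ := hch
    have h3 := Ast_mono hst h2
    rw [← this i hi] at h3
    rw [Ast_mono hrs h3] at h1
    exact absurd h1 (by decide)
  ch_mono := fun s d d' hd h => by
    rw [cch_iff] at *
    obtain ⟨i, hi, h1⟩ := h
    exact ⟨i, by omega, h1⟩
  ch_fin := ch_fin_aux cA
  wt_nonneg := fun p => by positivity
  kraft := fun F hF => by
    have h1 : ∀ p ∈ F, ∃ ρ : Str, Encodable.encode ρ = p ∧ ρ.length = len p ∧ (U ρ).Dom := by
      intro p hp
      obtain ⟨s, hs⟩ := hF p hp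
      obtain ⟨σ, hσ⟩ := cborn_iff.1 hs
      obtain ⟨ρ, a, b, c⟩ := uu_sound hc hσ
      exact ⟨ρ, a, b, Part.dom_iff_mem.2 ⟨σ, c⟩⟩
    let f : ℕ → Str := fun p => (pg p).getD []
    have hf : ∀ p ∈ F, Encodable.encode (f p) = p ∧ (f p).length = len p ∧ (U (f p)).Dom := by
      intro p hp
      obtain ⟨ρ, a, b⟩ := h1 p hp
      have : f p = ρ := by simp only [f]; rw [pg_iff.2 a]; rfl
      rw [this]; exact ⟨a, b⟩
    have hinj : Set.InjOn f F := by
      intro a ha b hb hab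
      rw [← (hf a ha).1, ← (hf b hb).1, hab]
    have := kraft_str (F.image f) (by
      intro a ha b hb hab
      obtain ⟨p, hp, rfl⟩ := Finset.mem_image.1 ha
      obtain ⟨q, hq, rfl⟩ := Finset.mem_image.1 hb
      exact hU.2 _ _ (hf p hp).2.2 (hf q hq).2.2 hab)
    rw [Finset.sum_image hinj] at this
    refine le_trans (le_of_eq ?_) this
    apply Finset.sum_congr rfl
    intro p hp
    rw [(hf p hp).2.1]

theorem On_real (cA cU : Code) (U : Str →. Str) (hU : PFMachine U) (hc : Computes cU U) (s : ℕ) :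
    (On cU s : ℝ) = 2 ^ s * (mkSys0 cA cU U hU hc).Om s := by
  unfold On Sys0.Om
  rw [Finset.sum_filter, Finset.mul_sum]
  push_cast
  apply Finset.sum_congr rfl
  intro p hp
  have e1 : (mkSys0 cA cU U hU hc).born p s = cborn cU p s := rfl
  have e2 : (mkSys0 cA cU U hU hc).wt p = (1/2)^len p := rfl
  rw [e1, e2]
  rcases h : cborn cU p s
  · simp
  · obtain ⟨σ, hσ⟩ := cborn_iff.1 h
    have := len_lt hσ
    simp only [cond_true, if_true]
    push_cast
    rw [pow_sub₀ _ (by norm_num) this.le]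
    simp

theorem nnS_eq {cU : Code} {p s : ℕ} {σ : Str} (h : uu cU p s = Option.some σ) :
    nnS cU p s = (uuInf cU p).length := by
  unfold nnS; rw [uuInf_eq h, h]; rfl

theorem Wn_real (cA cU : Code) (U : Str →. Str) (hU : PFMachine U) (hc : Computes cU U) (s d : ℕ) :
    (Wn cA cU s d : ℝ) = 2 ^ s * (mkSys0 cA cU U hU hc).W s d := by
  unfold Wn Sys0.W Sys0.aset
  rw [Finset.sum_filter, Finset.mul_sum]
  push_cast
  apply Finset.sum_congr rfl
  intro p hp
  have e1 : (mkSys0 cA cU U hU hc).al p s = cal cA cU p s := rfl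
  have e2 : (mkSys0 cA cU U hU hc).wt p = (1/2)^len p := rfl
  have e3 : (mkSys0 cA cU U hU hc).nn p = (uuInf cU p).length := rfl
  rw [e1, e2, e3]
  rcases h : cal cA cU p s
  · simp
  · have hσ := cal_iff.1 h
    have := len_lt hσ
    rw [nnS_eq hσ]
    by_cases hd : d ≤ (uuInf cU p).length
    · simp only [hd, decide_true, Bool.and_self, cond_true, and_self, if_true]
      push_cast
      rw [pow_sub₀ _ (by norm_num) this.le]
      simp
    · simp [hd]

theorem nlt_real (cA cU : Code) (U : Str →. Str) (hU : PFMachine U) (hc : Computes cU U)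
    (s e g d h : ℕ) (he : e ≤ s) : nlt cA cU s e g d h = true ↔
      h ≤ g ∨ (mkSys0 cA cU U hU hc).W (s+1) d ≤ 
        (1/8)^h * ((mkSys0 cA cU U hU hc).Om (s+1) - (mkSys0 cA cU U hU hc).Om e) := by
  unfold nlt
  simp only [Bool.or_eq_true, decide_eq_true_eq]
  apply or_congr Iff.rfl
  rw [← Nat.cast_le (α := ℝ)]
  push_cast
  rw [On_real cA cU U hU hc, On_real cA cU U hU hc, Wn_real cA cU U hU hc]
  set W := (mkSys0 cA cU U hU hc).W (s+1) d
  set O1 := (mkSys0 cA cU U hU hc).Om (s+1)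
  set O2 := (mkSys0 cA cU U hU hc).Om e
  have p1 : (2:ℝ)^(s+1-e) * 2 ^ e = 2 ^ (s+1) := by rw [← pow_add]; congr 1; omega
  have p2 : (0:ℝ) < 2 ^ (s+1) := by positivity
  have p3 : ((1:ℝ)/8)^h * 8 ^ h = 1 := by rw [← mul_pow]; norm_num
  have p4 : (0:ℝ) < 8 ^ h := by positivity
  have p5 : (0:ℝ) < (1/8) ^ h := by positivity
  have e1 : (8:ℝ)^h * (2^(s+1) * W) + 2^(s+1-e) * (2^e * O2) ≤ 2^(s+1) * O1 ↔ 
      2^(s+1) * (8^h * W) ≤ 2^(s+1) * (O1 - O2) := by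
    have : (2:ℝ)^(s+1-e) * (2^e * O2) = 2^(s+1) * O2 := by rw [← mul_assoc, p1]
    rw [this]
    constructor <;> intro h <;> linarith
  rw [e1, mul_le_mul_iff_right₀ p2]
  constructor
  · intro h'
    have := mul_le_mul_of_nonneg_left h' p5.le
    rwa [← mul_assoc, p3, one_mul] at this
  · intro h'
    have := mul_le_mul_of_nonneg_left h' p4.le
    rwa [← mul_assoc, mul_comm (8^h) ((1/8:ℝ)^h), p3, one_mul] at this

noncomputable def mkSys (cA cU : Code) (U : Str →. Str) (hU : PFMachine U) (hc : Computes cU U) : Sys where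
  toSys0 := mkSys0 cA cU U hU hc
  nl := cnl cA cU
  nl_ge := fun s e g d h hg => by
    apply Nat.le_findGreatest hg
    unfold nlt; simp
  nl_le := fun s e g d h => Nat.findGreatest_le _
  nl_spec := fun s e g d h hg he => by
    have h1 : nlt cA cU s e g d (cnl cA cU s e g d h) = true := by
      have := Nat.findGreatest_of_ne_zero (P := fun h => nlt cA cU s e g d h = true) (n := h) 
        (m := cnl cA cU s e g d h) rfl (by omega)
      exact this
    rw [nlt_real cA cU U hU hc _ _ _ _ _ he] at h1
    rcases h1 with h1 | h1
    · omega
    · exact h1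
  nl_max := fun s e g d h k hk hkh he => by
    have := Nat.findGreatest_is_greatest (P := fun h => nlt cA cU s e g d h = true) hk hkh
    rw [nlt_real cA cU U hU hc _ _ _ _ _ he] at this
    push Not at this
    exact this.2

theorem primrec_sum {α : Type*} [Primcodable α] {f : α → ℕ → ℕ} {n : α → ℕ}
    (hf : Primrec₂ f) (hn : Primrec n) : Primrec fun a => ∑ p ∈ Finset.range (n a), f a p := by
  have h : Primrec fun a => Nat.rec (motive := fun _ => ℕ) 0 (fun p acc => acc + f a p) (n a) := by
    refine Primrec.nat_rec' (h := fun a (z : ℕ × ℕ) => z.2 + f a z.1) hn (Primrec.const 0) ?_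
    exact Primrec.nat_add.comp (Primrec.snd.comp Primrec.snd)
      (hf.comp Primrec.fst (Primrec.fst.comp Primrec.snd))
  refine h.of_eq fun a => ?_
  induction n a with
  | zero => simp
  | succ k ih => rw [Finset.sum_range_succ, ← ih]

theorem primrec_Ast (cA : Code) : Primrec₂ (Ast cA) := by
  have : Primrec fun z : ℕ × ℕ => Code.evaln z.1 cA z.2 :=
    Code.primrec_evaln.comp (Primrec.pair (Primrec.pair Primrec.fst (Primrec.const cA)) Primrec.snd)
  exact (Primrec.option_isSome.comp this)

theorem primrec_rs (cA : Code) : Primrec₂ (rs cA) := by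
  refine Primrec.list_map (Primrec.list_range.comp Primrec.snd) ?_
  exact (primrec_Ast cA).comp (Primrec.fst.comp Primrec.fst) Primrec.snd

theorem primrec_pg : Primrec pg := by
  refine Primrec.option_bind Primrec.decode ?_
  refine Primrec.cond ?_ (Primrec.option_some.comp Primrec.snd) (Primrec.const Option.none)
  exact (Primrec.eq.comp (Primrec.encode.comp Primrec.snd) Primrec.fst).decide.of_eq fun _ => by congr

theorem primrec_len : Primrec len := 
  Primrec.option_getD.comp (Primrec.option_map primrec_pg (Primrec.list_length.comp Primrec.snd)) 
    (Primrec.const 0)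

theorem primrec_uu (cU : Code) : Primrec₂ (uu cU) := by
  refine Primrec.option_bind (primrec_pg.comp Primrec.fst) ?_
  have hz : Primrec fun z : (ℕ × ℕ) × Str => z.1 := Primrec.fst
  refine Primrec.option_bind (Code.primrec_evaln.comp 
    (Primrec.pair (Primrec.pair (Primrec.snd.comp hz) (Primrec.const cU)) (Primrec.fst.comp hz))) ?_
  refine Primrec.option_bind (Primrec.decode.comp Primrec.snd) ?_
  refine Primrec.cond ?_ (Primrec.option_some.comp Primrec.snd) (Primrec.const Option.none)
  exact (Primrec.nat_lt.comp (Primrec.list_length.comp Primrec.snd) 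
    (Primrec.snd.comp (Primrec.fst.comp (Primrec.fst.comp Primrec.fst)))).decide.of_eq 
      fun _ => by congr

theorem primrec_cborn (cU : Code) : Primrec₂ (cborn cU) := 
  Primrec.option_isSome.comp (primrec_uu cU)

theorem primrec_cal (cA cU : Code) : Primrec₂ (cal cA cU) := by
  refine Primrec.option_getD.comp (Primrec.option_map (primrec_uu cU) ?_) (Primrec.const false)
  exact (Primrec.eq.comp Primrec.snd ((primrec_rs cA).comp (Primrec.snd.comp Primrec.fst)
    (Primrec.list_length.comp Primrec.snd))).decide.of_eq fun _ => by congr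

theorem primrec_cch (cA : Code) : Primrec₂ (cch cA) := by
  refine Primrec.not.comp ?_
  exact (Primrec.eq.comp ((primrec_rs cA).comp (Primrec.succ.comp Primrec.fst) Primrec.snd)
    (primrec_rs cA)).decide.of_eq fun _ => by congr

theorem primrec_On (cU : Code) : Primrec (On cU) := by
  refine primrec_sum ?_ Primrec.id
  refine Primrec.cond ((primrec_cborn cU).comp Primrec.snd Primrec.fst) ?_ (Primrec.const 0)
  exact primrec_pow.comp (Primrec.const 2) (Primrec.nat_sub.comp Primrec.fst (primrec_len.comp Primrec.snd))

theorem primrec_nnS (cU : Code) : Primrec₂ (nnS cU) := by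
  exact Primrec.option_getD.comp (Primrec.option_map (primrec_uu cU) (Primrec.list_length.comp Primrec.snd)) 
    (Primrec.const 0)

theorem primrec_Wn (cA cU : Code) : Primrec₂ (Wn cA cU) := by
  refine primrec_sum (f := fun (a : ℕ × ℕ) p => bif cal cA cU p a.1 && decide (a.2 ≤ nnS cU p a.1) 
    then 2 ^ (a.1 - len p) else 0) ?_ Primrec.fst
  have h1 : Primrec fun z : (ℕ × ℕ) × ℕ => z.1.1 := Primrec.fst.comp Primrec.fst
  have h2 : Primrec fun z : (ℕ × ℕ) × ℕ => z.1.2 := Primrec.snd.comp Primrec.fst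
  refine Primrec.cond (Primrec.and.comp ((primrec_cal cA cU).comp Primrec.snd h1) ?_) ?_ (Primrec.const 0)
  · exact (Primrec.nat_le.comp h2 ((primrec_nnS cU).comp Primrec.snd h1)).decide.of_eq fun _ => by congr
  · exact primrec_pow.comp (Primrec.const 2) (Primrec.nat_sub.comp h1 (primrec_len.comp Primrec.snd))

theorem primrec_nlt (cA cU : Code) : Primrec fun z : ((ℕ × ℕ × ℕ) × ℕ × ℕ) × ℕ => 
    nlt cA cU z.1.1.1 z.1.1.2.1 z.1.1.2.2 z.1.2.1 z.2 := by
  have hs : Primrec fun z : ((ℕ × ℕ × ℕ) × ℕ × ℕ) × ℕ => z.1.1.1 := 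
    Primrec.fst.comp (Primrec.fst.comp Primrec.fst)
  have he : Primrec fun z : ((ℕ × ℕ × ℕ) × ℕ × ℕ) × ℕ => z.1.1.2.1 := 
    Primrec.fst.comp (Primrec.snd.comp (Primrec.fst.comp Primrec.fst))
  have hg : Primrec fun z : ((ℕ × ℕ × ℕ) × ℕ × ℕ) × ℕ => z.1.1.2.2 := 
    Primrec.snd.comp (Primrec.snd.comp (Primrec.fst.comp Primrec.fst))
  have hd : Primrec fun z : ((ℕ × ℕ × ℕ) × ℕ × ℕ) × ℕ => z.1.2.1 := 
    Primrec.fst.comp (Primrec.snd.comp Primrec.fst)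
  have hs1 := Primrec.succ.comp hs
  refine Primrec.or.comp ?_ ?_
  · exact (Primrec.nat_le.comp Primrec.snd hg).decide.of_eq fun _ => by congr
  · refine (Primrec.nat_le.comp (Primrec.nat_add.comp 
      (Primrec.nat_mul.comp (primrec_pow.comp (Primrec.const 8) Primrec.snd) 
        ((primrec_Wn cA cU).comp hs1 hd))
      (Primrec.nat_mul.comp (primrec_pow.comp (Primrec.const 2) (Primrec.nat_sub.comp hs1 he))
        ((primrec_On cU).comp he))) 
      ((primrec_On cU).comp hs1)).decide.of_eq fun _ => ?_
    congr

theorem primrec_cnl (cA cU : Code) : Primrec fun z : (ℕ × ℕ × ℕ) × ℕ × ℕ => 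
    cnl cA cU z.1.1 z.1.2.1 z.1.2.2 z.2.1 z.2.2 := by
  have h : PrimrecRel fun (z : (ℕ × ℕ × ℕ) × ℕ × ℕ) (h : ℕ) => 
      nlt cA cU z.1.1 z.1.2.1 z.1.2.2 z.2.1 h = true :=
    Primrec.eq.comp (primrec_nlt cA cU) (Primrec.const true)
  refine (Primrec.nat_findGreatest (Primrec.snd.comp Primrec.snd) h).of_eq fun z => ?_
  unfold cnl
  congr

theorem mk_ch (cA cU : Code) (U : Str →. Str) (hU : PFMachine U) (hc : Computes cU U) :
    Primrec₂ (mkSys cA cU U hU hc).ch := primrec_cch cA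

theorem mk_nl (cA cU : Code) (U : Str →. Str) (hU : PFMachine U) (hc : Computes cU U) :
    (mkSys cA cU U hU hc).NLP := primrec_cnl cA cU

namespace Sys
variable (Y : Sys) (hl : ℕ → ℕ → Bool)

/-- the coding marker for `k` placed at `x` has to move at stage `t` -/
def bad (k x t : ℕ) : Bool :=
  !decide (pos k (Y.st t) = pos k (Y.st x)) || (hl t k && !hl x k)

/-- stage `s` approximation of `B` -/
def Bs (s n : ℕ) : Bool :=
  Nat.rec (motive := fun _ => Bool) (decide (n.unpair.2 < n.unpair.1))
    (fun t acc => acc || (decide (n.unpair.2 < t + 1) && Y.bad hl n.unpair.1 n.unpair.2 (t+1))) s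

theorem Bs_zero (n : ℕ) : Y.Bs hl 0 n = decide (n.unpair.2 < n.unpair.1) := rfl

theorem Bs_succ (s n : ℕ) : Y.Bs hl (s+1) n = 
    (Y.Bs hl s n || (decide (n.unpair.2 < s + 1) && Y.bad hl n.unpair.1 n.unpair.2 (s+1))) := rfl

theorem Bs_mono {s t n : ℕ} (h : s ≤ t) (hs : Y.Bs hl s n = true) : Y.Bs hl t n = true := by
  induction t, h using Nat.le_induction with
  | base => exact hs
  | succ t _ ih => rw [Bs_succ, ih]; rfl

theorem Bs_iff {s n : ℕ} : Y.Bs hl s n = true ↔ n.unpair.2 < n.unpair.1 ∨ 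
    ∃ t, t ≤ s ∧ n.unpair.2 < t ∧ Y.bad hl n.unpair.1 n.unpair.2 t = true := by
  induction s with
  | zero =>
    rw [Bs_zero]
    simp only [decide_eq_true_eq]
    constructor
    · exact Or.inl
    · rintro (h | ⟨t, h1, h2, _⟩)
      · exact h
      · omega
  | succ s ih =>
    rw [Bs_succ, Bool.or_eq_true, ih, Bool.and_eq_true, decide_eq_true_eq]
    constructor
    · rintro ((h | ⟨t, h1, h2⟩) | h)
      · exact Or.inl h
      · exact Or.inr ⟨t, by omega, h2⟩
      · exact Or.inr ⟨s+1, le_rfl, h⟩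
    · rintro (h | ⟨t, h1, h2⟩)
      · exact Or.inl (Or.inl h)
      · rcases Nat.lt_or_ge t (s+1) with h' | h'
        · exact Or.inl (Or.inr ⟨t, by omega, h2⟩)
        · have : t = s+1 := by omega
          subst this
          exact Or.inr h2

def br (s n : ℕ) : Str := (List.range n).map (Y.Bs hl s)

theorem br_eq_iff {s t n : ℕ} : Y.br hl s n = Y.br hl t n ↔ ∀ i < n, Y.Bs hl s i = Y.Bs hl t i := by
  unfold br
  rw [List.map_inj_left]
  simp

/-- a request is issued for `p` at stage `s` -/
def Rq (p s : ℕ) : Prop :=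
  Y.al p (s+1) = true ∧ (Y.al p s = false ∨ Y.br hl (s+1) (Y.nn p) ≠ Y.br hl s (Y.nn p))

noncomputable def births (s : ℕ) : Finset ℕ :=
  (Finset.range (s+1)).filter fun p => Y.al p (s+1) = true ∧ Y.al p s = false

noncomputable def newh (s : ℕ) : Finset ℕ :=
  (Finset.range s).filter fun k => hl (s+1) k = true ∧ hl s k = false

noncomputable def haltSet (s : ℕ) : Finset ℕ :=
  (newh hl s).biUnion fun k => Y.aset s (pos k (Y.st s) - 1)

noncomputable def rqs (s : ℕ) : Finset ℕ :=
  (Finset.range (s+1)).filter fun p => Y.Rq hl p s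

theorem rqs_sub (s : ℕ) : Y.rqs hl s ⊆ Y.births s ∪ (Y.costSet s 0 0 (Y.st s) ∪ Y.haltSet hl s) := by
  intro p hp
  unfold rqs at hp
  rw [Finset.mem_filter, Finset.mem_range] at hp
  obtain ⟨hps, h1, h2⟩ := hp
  rw [Finset.mem_union]
  by_cases hal : Y.al p s = true
  · right
    rcases h2 with h2 | h2
    · rw [hal] at h2; exact absurd h2 (by decide)
    rw [Ne, br_eq_iff] at h2
    push Not at h2
    obtain ⟨n, hn, hne⟩ := h2
    have hf : Y.Bs hl s n = false := by
      by_contra h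
      rw [Bool.not_eq_false] at h
      rw [h, Y.Bs_mono hl (Nat.le_succ s) h] at hne
      exact hne rfl
    have ht : Y.Bs hl (s+1) n = true := by
      by_contra h
      rw [Bool.not_eq_true] at h
      rw [h, hf] at hne
      exact hne rfl
    set k := n.unpair.1 with hk
    set x := n.unpair.2 with hx
    have hxn : x ≤ n := Nat.unpair_right_le n
    have hns := Y.al_nn _ _ hal
    have hf' : ¬ (Y.Bs hl s n = true) := by rw [hf]; decide
    rw [Bs_iff] at hf'
    push Not at hf'
    obtain ⟨hkx, hf2⟩ := hf'
    have hb := hf2 s le_rfl (by omega)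
    rw [Bs_succ, hf, Bool.false_or, Bool.and_eq_true] at ht
    have hb' := ht.2
    rw [← hk, ← hx] at hb'
    rw [← hk, ← hx] at hb
    unfold bad at hb hb'
    have hb1 : Y.bad hl k x s = false := by simpa [bad] using hb
    unfold bad at hb1
    rw [Bool.or_eq_false_iff] at hb1
    obtain ⟨hb1, hb2⟩ := hb1
    have hpos : pos k (Y.st s) = pos k (Y.st x) := by simpa using hb1
    obtain ⟨d, hd⟩ := Nat.exists_eq_succ_of_ne_zero (Y.pos_st_ne (k := k) (s := x) (by omega))
    have hdx := (Y.pos_W _ 0 0 (by omega) (Y.Srt_st x) hd).2.2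
    have hds : pos k (Y.st s) = d + 1 := by rw [hpos]; exact hd
    rw [Finset.mem_union]
    rw [Bool.or_eq_true] at hb'
    rcases hb' with hb' | hb'
    · left
      have hne' : pos k (Y.st (s+1)) ≠ d+1 := by
        have : pos k (Y.st (s+1)) ≠ pos k (Y.st x) := by simpa using hb'
        rw [hd] at this; exact this
      have hc0 := Y.not_ch_of_al hal le_rfl (Nat.lt_succ_self s) h1
      have hc : Y.ch s d = false := by
        by_contra h
        rw [Bool.not_eq_false] at h
        rw [Y.ch_mono s d (Y.nn p) (by omega) h] at hc0
        exact absurd hc0 (by decide)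
      obtain ⟨j, hj, hjd⟩ := Y.pos_change hc _ 0 0 (Y.Srt_st s) hds hne'
      unfold costSet
      rw [hj]
      simp only
      rw [Finset.mem_filter, Y.mem_aset]
      exact ⟨⟨hal, by omega⟩, h1⟩
    · right
      unfold haltSet
      rw [Finset.mem_biUnion]
      rw [Bool.and_eq_true] at hb'
      have hx0 : hl x k = false := by simpa using hb'.2
      refine ⟨k, ?_, ?_⟩
      · unfold newh
        rw [Finset.mem_filter, Finset.mem_range]
        refine ⟨by omega, hb'.1, ?_⟩
        rw [hx0] at hb2
        simpa using hb2
      · rw [Y.mem_aset, hds]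
        exact ⟨hal, by omega⟩
  · left
    unfold births
    rw [Finset.mem_filter, Finset.mem_range]
    exact ⟨hps, h1, by simpa using hal⟩

theorem births_bound (N : ℕ) : ∑ s ∈ Finset.range N, Y.wts (Y.births s) ≤ 1 := by
  have : ∑ s ∈ Finset.range N, Y.wts (Y.births s) = Y.wts ((Finset.range N).biUnion Y.births) := by
    unfold Sys0.wts
    rw [Finset.sum_biUnion]
    intro t _ t' _ hne
    have main : ∀ t t', t < t' → Disjoint (Y.births t) (Y.births t') := by
      intro t t' hlt
      rw [Finset.disjoint_left]
      intro p hp hp'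
      unfold births at hp hp'
      rw [Finset.mem_filter] at hp hp'
      have := Y.al_convex hp.2.1 hp'.2.1 t' (by omega) (by omega)
      rw [hp'.2.2] at this
      exact absurd this (by decide)
    rcases Nat.lt_or_gt_of_ne hne with h | h
    · exact main _ _ h
    · exact (main _ _ h).symm
  rw [this]
  apply Y.wts_ever
  intro p hp
  rw [Finset.mem_biUnion] at hp
  obtain ⟨s, _, hs⟩ := hp
  exact ⟨s+1, (Finset.mem_filter.1 hs).2.1⟩

theorem wts_union (F G : Finset ℕ) : Y.wts (F ∪ G) ≤ Y.wts F + Y.wts G := by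
  unfold Sys0.wts
  rw [← Finset.sum_union_inter]
  have : 0 ≤ ∑ p ∈ F ∩ G, Y.wt p := Y.wts_nonneg _
  linarith

theorem haltSet_le (s : ℕ) : Y.wts (Y.haltSet hl s) ≤ ∑ k ∈ newh hl s, ((1:ℝ)/8)^(k+1) := by
  have gen : ∀ (K : Finset ℕ) (f : ℕ → Finset ℕ), Y.wts (K.biUnion f) ≤ ∑ k ∈ K, Y.wts (f k) := by
    intro K f
    induction K using Finset.induction_on with
    | empty => simp [Sys0.wts]
    | insert a K ha ih =>
      rw [Finset.biUnion_insert, Finset.sum_insert ha]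
      have := Y.wts_union (f a) (K.biUnion f)
      linarith
  refine (gen _ _).trans (Finset.sum_le_sum fun k hk => ?_)
  unfold newh at hk
  rw [Finset.mem_filter, Finset.mem_range] at hk
  obtain ⟨d, hd⟩ := Nat.exists_eq_succ_of_ne_zero (Y.pos_st_ne (k := k) (s := s) (by omega))
  have := (Y.pos_W _ 0 0 (by omega) (Y.Srt_st s) hd).1
  rw [hd]
  exact this

theorem geo8 (N : ℕ) : ∑ k ∈ Finset.range N, ((1:ℝ)/8)^(k+1) ≤ 1 := by
  have : ∀ N, ∑ k ∈ Finset.range N, ((1:ℝ)/8)^(k+1) ≤ 1 - (1/8)^N := by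
    intro N
    induction N with
    | zero => simp
    | succ N ih =>
      rw [Finset.sum_range_succ, pow_succ]
      have : (0:ℝ) ≤ (1/8)^N := by positivity
      linarith
  have h2 : (0:ℝ) ≤ (1/8)^N := by positivity
  linarith [this N]

theorem newh_bound (hm : ∀ s t k, s ≤ t → hl s k = true → hl t k = true) (N : ℕ) :
    ∑ s ∈ Finset.range N, ∑ k ∈ newh hl s, ((1:ℝ)/8)^(k+1) ≤ 1 := by
  have : ∑ s ∈ Finset.range N, ∑ k ∈ newh hl s, ((1:ℝ)/8)^(k+1) = 
      ∑ k ∈ (Finset.range N).biUnion (newh hl), ((1:ℝ)/8)^(k+1) := by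
    rw [Finset.sum_biUnion]
    intro t _ t' _ hne
    have main : ∀ t t', t < t' → Disjoint (newh hl t) (newh hl t') := by
      intro t t' hlt
      rw [Finset.disjoint_left]
      intro p hp hp'
      unfold newh at hp hp'
      rw [Finset.mem_filter] at hp hp'
      have := hm (t+1) t' p hlt hp.2.1
      rw [hp'.2.2] at this
      exact absurd this (by decide)
    rcases Nat.lt_or_gt_of_ne hne with h | h
    · exact main _ _ h
    · exact (main _ _ h).symm
  rw [this]
  refine le_trans ?_ (geo8 N)
  apply Finset.sum_le_sum_of_subset_of_nonneg
  · intro k hk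
    rw [Finset.mem_biUnion] at hk
    obtain ⟨s, hs, hk⟩ := hk
    unfold newh at hk
    rw [Finset.mem_filter, Finset.mem_range] at hk
    rw [Finset.mem_range] at *
    omega
  · intro _ _ _; positivity

theorem rqs_bound (hm : ∀ s t k, s ≤ t → hl s k = true → hl t k = true) (N : ℕ) :
    ∑ s ∈ Finset.range N, Y.wts (Y.rqs hl s) ≤ 4 := by
  have h : ∀ s ∈ Finset.range N, Y.wts (Y.rqs hl s) ≤ Y.wts (Y.births s) + 
      (Y.wts (Y.costSet s 0 0 (Y.st s)) + ∑ k ∈ newh hl s, ((1:ℝ)/8)^(k+1)) := by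
    intro s _
    have a1 := Y.wts_mono (Y.rqs_sub hl s)
    have a2 := Y.wts_union (Y.births s) (Y.costSet s 0 0 (Y.st s) ∪ Y.haltSet hl s)
    have a3 := Y.wts_union (Y.costSet s 0 0 (Y.st s)) (Y.haltSet hl s)
    have a4 := Y.haltSet_le hl s
    linarith
  have := Finset.sum_le_sum h
  rw [Finset.sum_add_distrib, Finset.sum_add_distrib] at this
  have b1 := Y.births_bound N
  have b2 := Y.cost_bound N
  have b3 := newh_bound hl hm N
  linarith

theorem bad_primrec (hch : Primrec₂ Y.ch) (hnl : Y.NLP) (hhl : Primrec₂ hl) :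
    Primrec fun z : ℕ × ℕ × ℕ => Y.bad hl z.1 z.2.1 z.2.2 := by
  have hk : Primrec fun z : ℕ × ℕ × ℕ => z.1 := Primrec.fst
  have hx : Primrec fun z : ℕ × ℕ × ℕ => z.2.1 := Primrec.fst.comp Primrec.snd
  have ht : Primrec fun z : ℕ × ℕ × ℕ => z.2.2 := Primrec.snd.comp Primrec.snd
  have hst := Y.st_primrec hch hnl
  refine Primrec.or.comp (Primrec.not.comp ?_) (Primrec.and.comp (hhl.comp ht hk) 
    (Primrec.not.comp (hhl.comp hx hk)))
  exact (Primrec.eq.comp (pos_primrec.comp hk (hst.comp ht)) 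
    (pos_primrec.comp hk (hst.comp hx))).decide.of_eq fun _ => by congr

theorem Bs_primrec (hch : Primrec₂ Y.ch) (hnl : Y.NLP) (hhl : Primrec₂ hl) :
    Primrec₂ (Y.Bs hl) := by
  have hb := Y.bad_primrec hl hch hnl hhl
  have u1 : Primrec fun z : ℕ × ℕ => z.2.unpair.1 := 
    Primrec.fst.comp (Primrec.unpair.comp Primrec.snd)
  have u2 : Primrec fun z : ℕ × ℕ => z.2.unpair.2 := 
    Primrec.snd.comp (Primrec.unpair.comp Primrec.snd)
  refine Primrec.nat_rec' (f := fun z : ℕ × ℕ => z.1) 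
    (g := fun z : ℕ × ℕ => decide (z.2.unpair.2 < z.2.unpair.1))
    (h := fun (z : ℕ × ℕ) (w : ℕ × Bool) => (w.2 || (decide (z.2.unpair.2 < w.1 + 1) && 
      Y.bad hl z.2.unpair.1 z.2.unpair.2 (w.1+1)))) Primrec.fst ?_ ?_
  · exact (Primrec.nat_lt.comp u2 u1).decide.of_eq fun _ => by congr
  · have w1 : Primrec fun z : (ℕ × ℕ) × ℕ × Bool => z.2.1 + 1 := 
      Primrec.succ.comp (Primrec.fst.comp Primrec.snd)
    refine Primrec.or.comp (Primrec.snd.comp Primrec.snd) (Primrec.and.comp ?_ ?_)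
    · exact (Primrec.nat_lt.comp (u2.comp Primrec.fst) w1).decide.of_eq fun _ => by congr
    · exact hb.comp (Primrec.pair (u1.comp Primrec.fst) (Primrec.pair (u2.comp Primrec.fst) w1))

theorem br_primrec (hch : Primrec₂ Y.ch) (hnl : Y.NLP) (hhl : Primrec₂ hl) :
    Primrec₂ (Y.br hl) := by
  refine Primrec.list_map (Primrec.list_range.comp Primrec.snd) ?_
  exact (Y.Bs_primrec hl hch hnl hhl).comp (Primrec.fst.comp Primrec.fst) Primrec.snd

end Sys

theorem kc_machine (f : Reqs) (hf : Computable f) (hs : ∀ N, ∑ j ∈ Finset.range N, rwt f j ≤ 1/2) :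
    ∃ M : Str →. Str, PFMachine M ∧ ∀ i a, f i = Option.some a → ∃ ρ : Str, ρ.length = a.1 ∧ a.2 ∈ M ρ := by
  obtain ⟨M, hM, h⟩ := pf_of_graph (kG f) (kG_comp f hf) (by
    intro i j a b ha hb hab
    by_cases hij : i = j
    · subst hij; rw [ha] at hb; exact Option.some.inj hb
    · exact absurd hab (kG_inc hs hij ha hb))
  refine ⟨M, hM, fun i a ha => ?_⟩
  have := h i (kcode (kst f i) a.1, a.2) (by unfold kG; rw [ha]; rfl)
  exact ⟨_, (kcode_spec hs ha).1, this⟩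

theorem sum_pair (f : Reqs) (g : ℕ → ℕ → ℝ) (hg : ∀ q t, 0 ≤ g q t)
    (h : ∀ i, rwt f i ≤ g i.unpair.1 i.unpair.2) (N : ℕ) :
    ∑ i ∈ Finset.range N, rwt f i ≤ ∑ t ∈ Finset.range N, ∑ q ∈ Finset.range N, g q t := by
  rw [← Finset.sum_product_right (f := fun z : ℕ × ℕ => g z.1 z.2)]
  refine (Finset.sum_le_sum fun i _ => h i).trans ?_
  have e : ∑ i ∈ Finset.range N, g i.unpair.1 i.unpair.2 = 
      ∑ z ∈ (Finset.range N).image Nat.unpair, g z.1 z.2 := by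
    rw [Finset.sum_image]
    intro a _ b _ hab
    rw [← Nat.pair_unpair a, ← Nat.pair_unpair b, hab]
  rw [e]
  apply Finset.sum_le_sum_of_subset_of_nonneg
  · intro z hz
    obtain ⟨i, hi, rfl⟩ := Finset.mem_image.1 hz
    rw [Finset.mem_range] at hi
    rw [Finset.mem_product, Finset.mem_range, Finset.mem_range]
    exact ⟨(Nat.unpair_left_le i).trans_lt hi, (Nat.unpair_right_le i).trans_lt hi⟩
  · intro z _ _; exact hg _ _

theorem Ast_lim {cA : Code} {A : Set ℕ} (hcA : ∀ n, n ∈ A ↔ (Code.eval cA n).Dom) (n : ℕ) :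
    n ∈ A ↔ ∃ s, Ast cA s n = true := by
  rw [hcA, Part.dom_iff_mem]
  constructor
  · rintro ⟨v, hv⟩
    obtain ⟨s, hs⟩ := Code.evaln_complete.1 hv
    exact ⟨s, by unfold Ast; rw [Option.mem_def.1 hs]; rfl⟩
  · rintro ⟨s, hs⟩
    obtain ⟨v, hv⟩ := Option.isSome_iff_exists.1 hs
    exact ⟨v, Code.evaln_sound hv⟩

theorem rs_const {cA : Code} {t d : ℕ} (h : ∀ t', t < t' → cch cA t' d = false) : 
    ∀ t', t + 1 ≤ t' → rs cA t' d = rs cA (t+1) d := by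
  intro t' ht
  induction t', ht using Nat.le_induction with
  | base => rfl
  | succ t' ht ih =>
    rw [← ih]
    have := h t' (by omega)
    unfold cch at this
    simpa using this

theorem rs_final {cA : Code} {A : Set ℕ} (hcA : ∀ n, n ∈ A ↔ (Code.eval cA n).Dom) {t d m : ℕ}
    (h : ∀ t', t + 1 ≤ t' → rs cA t' d = rs cA (t+1) d) (hm : m ≤ d) :
    rs cA (t+1) m = restrSet A m := by
  unfold rs restrSet
  rw [List.map_inj_left]
  intro i hi
  rw [List.mem_range] at hi
  by_cases hiA : i ∈ A
  · obtain ⟨s, hs⟩ := (Ast_lim hcA i).1 hiA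
    have h1 := h (max s (t+1)) (le_max_right _ _)
    rw [rs_eq_iff] at h1
    rw [← h1 i (by omega), Ast_mono (le_max_left _ _) hs]
    simp [hiA]
  · have : Ast cA (t+1) i = false := by
      by_contra hcon
      rw [Bool.not_eq_false] at hcon
      exact hiA ((Ast_lim hcA i).2 ⟨_, hcon⟩)
    rw [this]; simp [hiA]

def evReq (cA cU : Code) (k : ℕ) (E : ℕ → Option (ℕ × ℕ)) (i : ℕ) : Option (ℕ × Str) :=
  (E i.unpair.2).bind fun o => 
    bif cborn cU i.unpair.1 o.2 && !cborn cU i.unpair.1 o.1 then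
      Option.some (len i.unpair.1 + (3 * (k+1) + 1), rs cA (i.unpair.2+1) (nnS cU i.unpair.1 o.2))
    else Option.none

theorem evReq_primrec (cA cU : Code) (k : ℕ) (E : ℕ → Option (ℕ × ℕ)) (hE : Primrec E) :
    Primrec (evReq cA cU k E) := by
  have u1 : Primrec fun z : ℕ => z.unpair.1 := Primrec.fst.comp Primrec.unpair
  have u2 : Primrec fun z : ℕ => z.unpair.2 := Primrec.snd.comp Primrec.unpair
  have v1 : Primrec fun z : ℕ × ℕ × ℕ => z.1.unpair.1 := u1.comp Primrec.fst
  have v2 : Primrec fun z : ℕ × ℕ × ℕ => z.1.unpair.2 := u2.comp Primrec.fst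
  have o1 : Primrec fun z : ℕ × ℕ × ℕ => z.2.1 := Primrec.fst.comp Primrec.snd
  have o2 : Primrec fun z : ℕ × ℕ × ℕ => z.2.2 := Primrec.snd.comp Primrec.snd
  refine Primrec.option_bind (hE.comp u2) ?_
  refine Primrec.cond (Primrec.and.comp ((primrec_cborn cU).comp v1 o2) 
    (Primrec.not.comp ((primrec_cborn cU).comp v1 o1))) ?_ (Primrec.const Option.none)
  refine Primrec.option_some.comp (Primrec.pair ?_ ?_)
  · exact Primrec.nat_add.comp (primrec_len.comp v1) (Primrec.const _)
  · exact (primrec_rs cA).comp (Primrec.succ.comp v2) ((primrec_nnS cU).comp v1 o2)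

theorem pos_conv {U : Str →. Str} (hU : OptimalPF U) {A : Set ℕ} {cA cU : Code}
    (hcA : ∀ n, n ∈ A ↔ (Code.eval cA n).Dom) (hc : Computes cU U) (hAnt : ¬ KTrivialSet U A) (k : ℕ) :
    ∃ x, ∀ t, x ≤ t → Sys.pos k ((mkSys cA cU U hU.1 hc).st t) = Sys.pos k ((mkSys cA cU U hU.1 hc).st x) := by
  set Y := mkSys cA cU U hU.1 hc with hY
  rcases Y.converge k with h | hev
  · exact h
  exfalso
  apply hAnt
  set E := fun t => Y.ev k t 0 0 (Y.st t) with hE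
  have hEp : Primrec E := Y.ev_primrec (mk_ch _ _ _ _ _) (mk_nl _ _ _ _ _) k
  set f : Reqs := evReq cA cU k E with hf
  let g : ℕ → ℕ → ℝ := fun q t => match E t with
    | Option.none => 0
    | Option.some o => if cborn cU q o.2 = true ∧ cborn cU q o.1 = false then 
        (1/8)^(k+1) / 2 * Y.wt q else 0
  have hg0 : ∀ q t, 0 ≤ g q t := by
    intro q t
    simp only [g]
    rcases E t with _ | o
    · exact le_rfl
    · simp only
      split_ifs
      · have := Y.wt_nonneg q; positivity
      · exact le_rfl
  have hfg : ∀ i, rwt f i ≤ g i.unpair.1 i.unpair.2 := by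
    intro i
    simp only [rwt, hf, evReq, g]
    rcases E i.unpair.2 with _ | o
    · simp
    · simp only [Option.bind_some]
      by_cases hb : cborn cU i.unpair.1 o.2 = true ∧ cborn cU i.unpair.1 o.1 = false
      · rw [if_pos hb]
        simp only [hb.1, hb.2, Bool.not_false, Bool.and_self, cond_true]
        have e1 : Y.wt i.unpair.1 = (1/2)^len i.unpair.1 := rfl
        rw [e1, pow_add, pow_add, pow_mul]
        norm_num
        linarith
      · rw [if_neg hb]
        have : (cborn cU i.unpair.1 o.2 && !cborn cU i.unpair.1 o.1) = false := by
          by_contra hcon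
          apply hb
          simpa using hcon
        rw [this]
        simp
  have hsum : ∀ N, ∑ j ∈ Finset.range N, rwt f j ≤ 1/2 := by
    intro N
    refine (sum_pair f g hg0 hfg N).trans ?_
    have h1 := Y.ev_sum k N
    have h2 : ∑ t ∈ Finset.range N, ∑ q ∈ Finset.range N, g q t ≤ 
        ∑ t ∈ Finset.range N, (1/2) * (match Y.ev k t 0 0 (Y.st t) with
      | Option.none => (0:ℝ)
      | Option.some o => (1/8)^(k+1) * (Y.Om o.2 - Y.Om o.1)) := by
      apply Finset.sum_le_sum
      intro t _
      rcases hEt : Y.ev k t 0 0 (Y.st t) with _ | ⟨e, d⟩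
      · have : ∀ q, g q t = 0 := by intro q; simp only [g, hE, hEt]
        simp [this]
      · have hed := (Y.ev_weight _ 0 0 (Y.Srt_st t) (Nat.zero_le _) hEt).2.2
        have hgq : ∀ q, g q t = if cborn cU q d = true ∧ cborn cU q e = false then 
          (1/8)^(k+1) / 2 * Y.wt q else 0 := by intro q; simp only [g, hE, hEt]
        simp only [hgq]
        rw [← Finset.sum_filter, ← Finset.mul_sum]
        have h3 : ∑ q ∈ (Finset.range N).filter (fun q => cborn cU q d = true ∧ cborn cU q e = false), 
            Y.wt q + Y.Om e ≤ Y.Om d := by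
          unfold Sys0.Om
          rw [← Finset.sum_union]
          · apply Finset.sum_le_sum_of_subset_of_nonneg
            · intro q hq
              rw [Finset.mem_union, Finset.mem_filter, Finset.mem_filter] at hq
              rw [Finset.mem_filter, Finset.mem_range]
              have hb : Y.born q d = true := by
                rcases hq with hq | hq
                · exact hq.2.1
                · exact Y.born_mono _ _ _ hed hq.2
              exact ⟨Y.born_lt _ _ hb, hb⟩
            · intro q _ _; exact Y.wt_nonneg q
          · rw [Finset.disjoint_left]
            intro q hq hq'
            rw [Finset.mem_filter] at hq hq'
            have e1 : Y.born q e = cborn cU q e := rfl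
            rw [e1, hq.2.2] at hq'
            exact absurd hq'.2 (by decide)
        have h4 : (0:ℝ) ≤ (1/8)^(k+1) := by positivity
        nlinarith
    rw [← Finset.mul_sum] at h2
    have h5 := mul_le_mul_of_nonneg_left h1 (show (0:ℝ) ≤ 1/2 by norm_num)
    rw [mul_one] at h5
    exact h2.trans h5
  obtain ⟨M, hM, hMs⟩ := kc_machine f (evReq_primrec cA cU k E hEp).to_comp hsum
  obtain ⟨c, hcM⟩ := hU.2 M hM
  refine ⟨3 * (k+1) + 1 + c + ∑ m ∈ Finset.range k, (KC U (restrSet A m)).toNat, fun m => ?_⟩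
  by_cases hmk : m < k
  · have h1 : (KC U (restrSet A m)).toNat ≤ ∑ m ∈ Finset.range k, (KC U (restrSet A m)).toNat :=
      Finset.single_le_sum (f := fun m => (KC U (restrSet A m)).toNat) (fun _ _ => Nat.zero_le _) 
        (Finset.mem_range.2 hmk)
    rw [← ENat.natCast_toNat (KC_ne_top hU (restrSet A m))]
    refine le_trans ?_ le_add_self
    rw [Nat.cast_le]
    omega
  · obtain ⟨ρ, hρ, hlen⟩ := KC_attain (KC_ne_top hU (zeroStr m))
    set q := Encodable.encode ρ with hq
    have hex : ∃ s, uu cU q s = Option.some (zeroStr m) := uu_complete hc hρ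
    set t0 := Nat.find hex with ht0
    have h0 : uu cU q t0 = Option.some (zeroStr m) := Nat.find_spec hex
    have hmt : m < t0 := by
      have := (uu_iff.1 h0).2.2
      simpa [zeroStr] using this
    obtain ⟨t, e, d, hE1, he, hd, hdt, hcl⟩ := hev t0 (by omega)
    have hd0 := uu_mono hd h0
    have hbd : cborn cU q d = true := cborn_iff.2 ⟨_, hd0⟩
    have hbe : cborn cU q e = false := by
      by_contra hcon
      rw [Bool.not_eq_false] at hcon
      obtain ⟨σ, hσ⟩ := cborn_iff.1 hcon
      have := uu_uniq hσ h0
      rw [this] at hσ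
      exact Nat.find_min hex he hσ
    have hnS : nnS cU q d = m := by unfold nnS; rw [hd0]; simp [zeroStr]
    have hfi : f (Nat.pair q t) = Option.some (len q + (3 * (k+1) + 1), rs cA (t+1) m) := by
      simp only [hf, evReq, Nat.unpair_pair]
      have : E t = Option.some (e, d) := hE1
      rw [this]
      simp [hbd, hbe, hnS]
    obtain ⟨ρ', hρl, hρm⟩ := hMs _ _ hfi
    simp only at hρl hρm
    rw [rs_final hcA (rs_const hcl) (by omega : m ≤ d)] at hρm
    have h1 := KC_le hρm
    rw [hρl, hq, len_encode] at h1
    have h2 := hcM (restrSet A m)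
    rw [hlen]
    calc KC U (restrSet A m) ≤ KC M (restrSet A m) + c := h2
      _ ≤ ((ρ.length + (3 * (k+1) + 1) : ℕ) : ℕ∞) + c := by gcongr
      _ ≤ _ := by
        norm_cast
        omega

theorem RecursiveIn.of_partrec {O : ℕ →. ℕ} {f : ℕ →. ℕ} (h : Nat.Partrec f) : RecursiveIn O f := by
  induction h with
  | zero => exact .zero
  | succ => exact .succ
  | left => exact .left
  | right => exact .right
  | pair _ _ h1 h2 => exact .pair h1 h2
  | comp _ _ h1 h2 => exact .comp h1 h2
  | prec _ _ h1 h2 => exact .prec h1 h2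
  | rfind _ h1 => exact .rfind h1

theorem RecursiveIn.of_eq' {O : ℕ →. ℕ} {f g : ℕ →. ℕ} (h : RecursiveIn O f) (e : ∀ n, g n = f n) :
    RecursiveIn O g := by
  have : g = f := funext e
  rw [this]; exact h

theorem partrec_of_computable {f : ℕ → ℕ} (h : Computable f) : Nat.Partrec (f : ℕ →. ℕ) :=
  Partrec.nat_iff.1 h.partrec

def hlt (t k : ℕ) : Bool := (Code.evaln t (Denumerable.ofNat Code k) k).isSome

theorem hlt_primrec : Primrec₂ hlt := by
  refine Primrec.option_isSome.comp ?_
  exact Code.primrec_evaln.comp (Primrec.pair (Primrec.pair Primrec.fst 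
    ((Primrec.ofNat Code).comp Primrec.snd)) Primrec.snd)

theorem hlt_mono (s t k : ℕ) (h : s ≤ t) (hs : hlt s k = true) : hlt t k = true := by
  unfold hlt at *
  rw [Option.isSome_iff_exists] at *
  obtain ⟨v, hv⟩ := hs
  exact ⟨v, Code.evaln_mono h hv⟩

theorem halting_iff (k : ℕ) : k ∈ haltingSet ↔ ∃ t, hlt t k = true := by
  unfold haltingSet
  rw [Set.mem_ofPred_eq, Part.dom_iff_mem]
  constructor
  · rintro ⟨v, hv⟩
    obtain ⟨s, hs⟩ := Code.evaln_complete.1 hv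
    exact ⟨s, by unfold hlt; rw [Option.mem_def.1 hs]; rfl⟩
  · rintro ⟨s, hs⟩
    obtain ⟨v, hv⟩ := Option.isSome_iff_exists.1 hs
    exact ⟨v, Code.evaln_sound hv⟩

theorem bool_ce (b : ℕ → ℕ → Bool) (hb : Primrec₂ b) :
    ∃ f : ℕ →. ℕ, Nat.Partrec f ∧ ∀ n, (∃ s, b s n = true) ↔ (f n).Dom := by
  refine ⟨fun n => Nat.rfind fun s => Part.some (b s n), ?_, fun n => ?_⟩
  · apply Partrec.nat_iff.1
    apply Partrec.rfind
    have h : Computable₂ fun n s : ℕ => b s n := (hb.comp Primrec.snd Primrec.fst).to_comp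
    exact h.partrec₂
  · refine Iff.trans ?_ Nat.rfind_dom.symm
    constructor
    · rintro ⟨s, hs⟩
      exact ⟨s, Part.mem_some_iff.2 hs.symm, fun _ => trivial⟩
    · rintro ⟨s, hs, _⟩
      exact ⟨s, (Part.mem_some_iff.1 hs).symm⟩

theorem ce_le_halting {B : Set ℕ} {f : ℕ →. ℕ} (hf : Nat.Partrec f) (hB : ∀ n, n ∈ B ↔ (f n).Dom) :
    TuringLeSet B haltingSet := by
  obtain ⟨c, hcf⟩ := Code.exists_code.1 hf
  set c' := Code.comp c Code.left with hc'
  let h : ℕ → ℕ := fun n => Encodable.encode (Code.curry c' n)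
  have hh : Computable h := by
    have : Primrec h := Primrec.encode.comp (Code.primrec₂_curry.comp (Primrec.const c') Primrec.id)
    exact this.to_comp
  have key : ∀ n, h n ∈ haltingSet ↔ n ∈ B := by
    intro n
    unfold haltingSet
    rw [Set.mem_ofPred_eq, hB, ← hcf]
    simp only [h, Denumerable.ofNat_encode, Code.eval_curry]
    simp only [hc', Code.eval, PFun.coe_val, Nat.unpair_pair]
    exact Iff.of_eq (congrArg Part.Dom (Part.bind_some n c.eval))
  have h1 : RecursiveIn (chi haltingSet) fun n => (h : ℕ →. ℕ) n >>= chi haltingSet :=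
    RecursiveIn.comp RecursiveIn.oracle (RecursiveIn.of_partrec (partrec_of_computable hh))
  unfold TuringLeSet
  refine h1.of_eq' fun n => ?_
  refine Eq.trans ?_ (Part.bind_some (h n) (chi haltingSet)).symm
  unfold chi
  simp only [key]

theorem halting_le {Y : Sys} (B : Set ℕ) (hB : ∀ n, n ∈ B ↔ ∃ s, Y.Bs hlt s n = true)
    (hconv : ∀ k, ∃ x, ∀ t, x ≤ t → Sys.pos k (Y.st t) = Sys.pos k (Y.st x)) :
    TuringLeSet haltingSet B := by
  have ex : ∀ k, ∃ x, Nat.pair k x ∉ B := by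
    intro k
    obtain ⟨x, hx⟩ := hconv k
    have : ∃ y, ∀ t, y ≤ t → hlt t k = hlt y k := by
      by_cases h : ∃ s, hlt s k = true
      · obtain ⟨s, hs⟩ := h
        exact ⟨s, fun t ht => by rw [hlt_mono _ _ _ ht hs, hs]⟩
      · push Not at h
        exact ⟨0, fun t _ => by
          have h1 : hlt t k = false := by simpa using h t
          have h2 : hlt 0 k = false := by simpa using h 0
          rw [h1, h2]⟩
    obtain ⟨y, hy⟩ := this
    refine ⟨x + y + k, ?_⟩
    rw [hB]
    rintro ⟨s, hs⟩
    rw [Sys.Bs_iff, Nat.unpair_pair] at hs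
    simp only at hs
    rcases hs with hs | ⟨t, _, ht, hb⟩
    · omega
    · unfold Sys.bad at hb
      rw [hx t (by omega), hx (x+y+k) (by omega), hy t (by omega), hy (x+y+k) (by omega)] at hb
      simp at hb
  have good : ∀ k x, Nat.pair k x ∉ B → (k ∈ haltingSet ↔ hlt x k = true) := by
    intro k x hx
    rw [halting_iff]
    constructor
    · rintro ⟨t, ht⟩
      by_contra hcon
      rw [Bool.not_eq_true] at hcon
      apply hx
      rw [hB]
      refine ⟨t, ?_⟩
      rw [Sys.Bs_iff, Nat.unpair_pair]
      right
      refine ⟨t, le_rfl, ?_, ?_⟩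
      · by_contra h
        rw [hlt_mono t x k (by simpa using h) ht] at hcon
        exact absurd hcon (by decide)
      · unfold Sys.bad
        simp [ht, hcon]
    · intro h; exact ⟨x, h⟩
  let F : ℕ → ℕ := fun z => bif hlt z.unpair.2 z.unpair.1 then 1 else 0
  have hF : Computable F := by
    have : Primrec F := Primrec.cond (hlt_primrec.comp (Primrec.snd.comp Primrec.unpair) 
      (Primrec.fst.comp Primrec.unpair)) (Primrec.const 1) (Primrec.const 0)
    exact this.to_comp
  have h1 : RecursiveIn (chi B) fun a => Nat.rfind fun n => (fun m => (decide (m = 0) : Bool)) <$> chi B (Nat.pair a n) :=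
    RecursiveIn.rfind RecursiveIn.oracle
  have h2 : RecursiveIn (chi B) ((fun n : ℕ => n : ℕ → ℕ) : ℕ →. ℕ) := 
    RecursiveIn.of_partrec (partrec_of_computable Computable.id)
  have h3 := RecursiveIn.comp (RecursiveIn.of_partrec (partrec_of_computable hF)) (RecursiveIn.pair h2 h1)
  unfold TuringLeSet
  refine h3.of_eq' fun k => ?_
  have hr : (Nat.find (ex k)) ∈ 
      Nat.rfind fun n => (fun m => (decide (m = 0) : Bool)) <$> chi B (Nat.pair k n) := by
    refine Nat.mem_rfind.2 ⟨?_, ?_⟩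
    · have := Nat.find_spec (ex k)
      simp [chi, this]
    · intro m hm
      have := Nat.find_min (ex k) hm
      rw [not_not] at this
      simp [chi, this]
  have e0 : (Nat.pair <$> (((fun n : ℕ => n : ℕ → ℕ) : ℕ →. ℕ) k) <*> 
      (Nat.rfind fun n => (fun m => (decide (m = 0) : Bool)) <$> chi B (Nat.pair k n))) = 
        Part.some (Nat.pair k (Nat.find (ex k))) := by
    rw [Part.eq_some_iff.2 hr]
    simp [Seq.seq]
  have e1 : ∀ P : Part ℕ, P = Part.some (Nat.pair k (Nat.find (ex k))) → 
      (P >>= (F : ℕ →. ℕ)) = Part.some (F (Nat.pair k (Nat.find (ex k)))) := by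
    rintro P rfl
    exact Part.bind_some _ _
  refine Eq.trans ?_ (e1 _ e0).symm
  have hg := good k _ (Nat.find_spec (ex k))
  simp only [F, Nat.unpair_pair]
  unfold chi
  by_cases hk : k ∈ haltingSet
  · rw [if_pos hk, hg.1 hk]; rfl
  · rw [if_neg hk]
    have : hlt (Nat.find (ex k)) k = false := by
      by_contra h; rw [Bool.not_eq_false] at h; exact hk (hg.2 h)
    rw [this]; rfl

theorem restrSet_length (A : Set ℕ) (n : ℕ) : (restrSet A n).length = n := by simp [restrSet]

theorem comp_graph (T : List (Str × Str)) (q0 : Str) (H : ℕ → Option (Str × Str)) (hH : Computable H) :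
    Computable fun i => (match T[i]? with
      | Option.some a => Option.some a
      | Option.none => (H (i - T.length)).map fun a => (q0 ++ a.1, a.2) : Option (Str × Str)) := by
  have h1 : Computable fun i : ℕ => T[i]? := 
    (Primrec.list_getElem?.comp (Primrec.const T) Primrec.id).to_comp
  have h2 : Computable fun i : ℕ => H (i - T.length) :=
    hH.comp (Primrec.nat_sub.comp Primrec.id (Primrec.const _)).to_comp
  have h3 : Computable fun i : ℕ => (H (i - T.length)).map fun a => (q0 ++ a.1, a.2) := by
    refine Computable.option_map h2 ?_
    have : Primrec fun z : ℕ × Str × Str => (q0 ++ z.2.1, z.2.2) :=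
      Primrec.pair (Primrec.list_append.comp (Primrec.const q0) (Primrec.fst.comp Primrec.snd))
        (Primrec.snd.comp Primrec.snd)
    exact this.to_comp
  have h4 : Computable₂ fun (_ : ℕ) (a : Str × Str) => Option.some a :=
    Computable.option_some.comp Computable.snd
  refine (Computable.option_casesOn h1 h3 h4).of_eq fun i => ?_
  rcases T[i]? with _ | a <;> rfl

/-- gluing a finite table with a Kraft-Chaitin machine placed above `q0` -/
theorem glue {U : Str →. Str} (hU : PFMachine U) (A : Set ℕ) (ρ : ℕ → Str) (τ : ℕ → Str) (n0 : ℕ)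
    (hρ : ∀ n, restrSet A n ∈ U (ρ n)) (q0 σ0 : Str) (hq : σ0 ∈ U q0) (hσ : ∀ n, σ0 ≠ restrSet A n)
    (f : Reqs) (hf : Computable f) (hs : ∀ N, ∑ j ∈ Finset.range N, rwt f j ≤ 1/2) :
    ∃ M : Str →. Str, PFMachine M ∧ (∀ n < n0, τ n ∈ M (ρ n)) ∧
      ∀ i a, f i = Option.some a → ∃ ρ' : Str, ρ'.length = q0.length + a.1 ∧ a.2 ∈ M ρ' := by
  set T : List (Str × Str) := (List.range n0).map fun n => (ρ n, τ n) with hT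
  set G : ℕ → Option (Str × Str) := fun i => (match T[i]? with
      | Option.some a => Option.some a
      | Option.none => (kG f (i - T.length)).map fun a => (q0 ++ a.1, a.2)) with hG
  have hTl : T.length = n0 := by simp [hT]
  have hcase : ∀ i a, G i = Option.some a → (i < n0 ∧ a = (ρ i, τ i)) ∨ 
      (n0 ≤ i ∧ ∃ b, kG f (i - n0) = Option.some b ∧ a = (q0 ++ b.1, b.2)) := by
    intro i a ha
    rcases Nat.lt_or_ge i n0 with h | h
    · left
      have : T[i]? = Option.some (ρ i, τ i) := by simp [hT, h]
      simp only [hG, this, Option.some.injEq] at ha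
      exact ⟨h, ha.symm⟩
    · right
      have : T[i]? = Option.none := by simp [hT, h]
      simp only [hG, this, hTl, Option.map_eq_some_iff] at ha
      obtain ⟨b, hb, rfl⟩ := ha
      exact ⟨h, b, hb, rfl⟩
  have hdρ : ∀ n, (U (ρ n)).Dom := fun n => Part.dom_iff_mem.2 ⟨_, hρ n⟩
  have hdq : (U q0).Dom := Part.dom_iff_mem.2 ⟨_, hq⟩
  have hnq : ∀ n, ρ n ≠ q0 := by
    intro n h
    have h1 := hρ n
    rw [h] at h1
    exact hσ n (Part.mem_unique hq h1)
  obtain ⟨M, hM, hMG⟩ := pf_of_graph G (comp_graph T q0 (kG f) (kG_comp f hf)) (by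
    intro i j a b ha hb hab
    rcases hcase i a ha with ⟨hi, rfl⟩ | ⟨hi, a', ha', rfl⟩
    · rcases hcase j b hb with ⟨hj, rfl⟩ | ⟨hj, b', hb', rfl⟩
      · have h1 := hU.2 _ _ (hdρ i) (hdρ j) hab
        have h2 := hρ i
        rw [h1] at h2
        have h3 := congrArg List.length (Part.mem_unique h2 (hρ j))
        rw [restrSet_length, restrSet_length] at h3
        rw [h3]
      · exfalso
        rcases pre_total hab (List.prefix_append q0 b'.1) with h | h
        · exact hnq i (hU.2 _ _ (hdρ i) hdq h)
        · exact hnq i (hU.2 _ _ hdq (hdρ i) h).symm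
    · rcases hcase j b hb with ⟨hj, rfl⟩ | ⟨hj, b', hb', rfl⟩
      · exfalso
        exact hnq j (hU.2 _ _ hdq (hdρ j) ((List.prefix_append q0 a'.1).trans hab)).symm
      · have hab' : a'.1 <+: b'.1 := (List.prefix_append_right_inj q0).1 hab
        by_cases hij : i - n0 = j - n0
        · rw [hij, hb'] at ha'
          rw [Option.some.inj ha']
        · exact absurd hab' (kG_inc hs hij ha' hb'))
  refine ⟨M, hM, fun n hn => ?_, fun i a ha => ?_⟩
  · exact hMG n (ρ n, τ n) (by
      have : T[n]? = Option.some (ρ n, τ n) := by simp [hT, hn]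
      simp only [hG, this])
  · refine ⟨q0 ++ kcode (kst f i) a.1, ?_, ?_⟩
    · rw [List.length_append, (kcode_spec hs ha).1]
    · refine hMG (n0 + i) (q0 ++ kcode (kst f i) a.1, a.2) ?_
      have h1 : T[n0 + i]? = Option.none := by simp [hT]
      have h2 : kG f i = Option.some (kcode (kst f i) a.1, a.2) := by unfold kG; rw [ha]; rfl
      simp only [hG, h1, hTl, Nat.add_sub_cancel_left, h2, Option.map_some]

/-- tail of a bounded sum of nonnegative terms -/
theorem tail_small (w : ℕ → ℝ) (hw : ∀ i, 0 ≤ w i) (C : ℝ) (hC : ∀ N, ∑ i ∈ Finset.range N, w i ≤ C)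
    (ε : ℝ) (hε : 0 < ε) : ∃ I, ∀ F : Finset ℕ, (∀ i ∈ F, I ≤ i) → ∑ i ∈ F, w i ≤ ε := by
  have hb : BddAbove (Set.range fun N => ∑ i ∈ Finset.range N, w i) := ⟨C, by rintro _ ⟨N, rfl⟩; exact hC N⟩
  obtain ⟨I, hI⟩ := exists_lt_of_lt_ciSup (f := fun N => ∑ i ∈ Finset.range N, w i) 
    (b := (⨆ N, ∑ i ∈ Finset.range N, w i) - ε) (by linarith)
  refine ⟨I, fun F hF => ?_⟩
  have h1 : ∑ i ∈ Finset.range I, w i + ∑ i ∈ F, w i ≤ ∑ i ∈ Finset.range (I + F.sup id + 1), w i := by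
    rw [← Finset.sum_union]
    · apply Finset.sum_le_sum_of_subset_of_nonneg
      · intro i hi
        rw [Finset.mem_union, Finset.mem_range] at hi
        rw [Finset.mem_range]
        rcases hi with hi | hi
        · omega
        · have : i ≤ F.sup id := Finset.le_sup (f := id) hi
          omega
      · intro i _ _; exact hw i
    · rw [Finset.disjoint_left]
      intro i hi hi'
      rw [Finset.mem_range] at hi
      have := hF i hi'
      omega
  have h2 := le_ciSup hb (I + F.sup id + 1)
  beta_reduce at h2 hI
  linarith

def rqB (Y : Sys) (cA cU : Code) (n0 p s : ℕ) : Bool :=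
  (cal cA cU p (s+1) && (!cal cA cU p s || 
    !decide (Y.br hlt (s+1) (nnS cU p (s+1)) = Y.br hlt s (nnS cU p (s+1))))) && 
    decide (n0 ≤ nnS cU p (s+1))

def rqF (Y : Sys) (cA cU : Code) (n0 l : ℕ) (i : ℕ) : Option (ℕ × Str) :=
  bif rqB Y cA cU n0 i.unpair.1 i.unpair.2 then 
    Option.some (len i.unpair.1 - l, Y.br hlt (i.unpair.2+1) (nnS cU i.unpair.1 (i.unpair.2+1)))
  else Option.none

theorem rqF_primrec (Y : Sys) (cA cU : Code) (n0 l : ℕ) (hbr : Primrec₂ (Y.br hlt)) :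
    Primrec (rqF Y cA cU n0 l) := by
  have u1 : Primrec fun z : ℕ => z.unpair.1 := Primrec.fst.comp Primrec.unpair
  have u2 : Primrec fun z : ℕ => z.unpair.2 := Primrec.snd.comp Primrec.unpair
  have u3 : Primrec fun z : ℕ => z.unpair.2 + 1 := Primrec.succ.comp u2
  have hn : Primrec fun z : ℕ => nnS cU z.unpair.1 (z.unpair.2 + 1) := (primrec_nnS cU).comp u1 u3
  refine Primrec.cond (Primrec.and.comp (Primrec.and.comp ((primrec_cal cA cU).comp u1 u3) 
    (Primrec.or.comp (Primrec.not.comp ((primrec_cal cA cU).comp u1 u2)) (Primrec.not.comp ?_))) ?_) ?_ 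
    (Primrec.const Option.none)
  · exact (Primrec.eq.comp (hbr.comp u3 hn) (hbr.comp u2 hn)).decide.of_eq fun _ => by congr
  · exact (Primrec.nat_le.comp (Primrec.const n0) hn).decide.of_eq fun _ => by congr
  · exact Primrec.option_some.comp (Primrec.pair (Primrec.nat_sub.comp (primrec_len.comp u1) 
      (Primrec.const l)) (hbr.comp u3 hn))

theorem rqB_iff {cA cU : Code} {U : Str →. Str} {hU : PFMachine U} {hc : Computes cU U} {n0 p s : ℕ} :
    rqB (mkSys cA cU U hU hc) cA cU n0 p s = true ↔ 
      (mkSys cA cU U hU hc).Rq hlt p s ∧ n0 ≤ (mkSys cA cU U hU hc).nn p := by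
  unfold rqB Sys.Rq
  have e1 : ∀ p s, (mkSys cA cU U hU hc).al p s = cal cA cU p s := fun _ _ => rfl
  have e2 : (mkSys cA cU U hU hc).nn p = (uuInf cU p).length := rfl
  rw [e1, e1, e2]
  rcases h : cal cA cU p (s+1)
  · simp
  · rw [nnS_eq (cal_iff.1 h)]
    simp

theorem br_lim (Y : Sys) (B : Set ℕ) (hB : ∀ n, n ∈ B ↔ ∃ s, Y.Bs hlt s n = true) (n : ℕ) :
    ∃ s0, ∀ s, s0 ≤ s → Y.br hlt s n = restrSet B n := by
  have key : ∀ i, ∃ s0, ∀ s, s0 ≤ s → Y.Bs hlt s i = decide (i ∈ B) := by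
    intro i
    by_cases h : i ∈ B
    · obtain ⟨s, hs⟩ := (hB i).1 h
      exact ⟨s, fun t ht => by rw [Y.Bs_mono hlt ht hs]; simp [h]⟩
    · refine ⟨0, fun t _ => ?_⟩
      have : Y.Bs hlt t i = false := by
        by_contra hcon
        rw [Bool.not_eq_false] at hcon
        exact h ((hB i).2 ⟨t, hcon⟩)
      rw [this]; simp [h]
  choose g hg using key
  refine ⟨(Finset.range n).sup g, fun s hs => ?_⟩
  unfold Sys.br restrSet
  rw [List.map_inj_left]
  intro i hi
  rw [List.mem_range] at hi
  have : g i ≤ (Finset.range n).sup g := Finset.le_sup (Finset.mem_range.2 hi)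
  exact hg i s (by omega)

theorem main_machine {U : Str →. Str} (hU : OptimalPF U) {A B : Set ℕ} {cA cU : Code}
    (hcA : ∀ n, n ∈ A ↔ (Code.eval cA n).Dom) (hc : Computes cU U)
    (hB : ∀ n, n ∈ B ↔ ∃ s, (mkSys cA cU U hU.1 hc).Bs hlt s n = true) :
    ∃ M : Str →. Str, PFMachine M ∧ ∀ n, KC M (restrSet B n) ≤ KC U (restrSet A n) := by
  set Y := mkSys cA cU U hU.1 hc with hY
  have hch : Primrec₂ Y.ch := mk_ch _ _ _ _ _
  have hnl : Y.NLP := mk_nl _ _ _ _ _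
  have hρ : ∀ n, ∃ ρ, restrSet A n ∈ U ρ ∧ KC U (restrSet A n) = (ρ.length : ℕ∞) := 
    fun n => KC_attain (KC_ne_top hU _)
  choose ρ hρ1 hρ2 using hρ
  obtain ⟨q0, hq0, -⟩ := KC_attain (KC_ne_top hU [!decide (0 ∈ A)])
  have hσ : ∀ n, [!decide (0 ∈ A)] ≠ restrSet A n := by
    intro n h
    have h1 := congrArg List.length h
    rw [restrSet_length] at h1
    have h2 : n = 1 := by simpa using h1.symm
    subst h2
    simp [restrSet] at h
  set l := q0.length with hl
  set w : ℕ → ℝ := fun i => if Y.Rq hlt i.unpair.1 i.unpair.2 then Y.wt i.unpair.1 else 0 with hw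
  have hw0 : ∀ i, 0 ≤ w i := by
    intro i
    simp only [hw]
    split_ifs
    · exact Y.wt_nonneg _
    · exact le_rfl
  have hw4 : ∀ N, ∑ i ∈ Finset.range N, w i ≤ 4 := by
    intro N
    refine le_trans ?_ (Y.rqs_bound hlt hlt_mono N)
    have e : ∑ i ∈ Finset.range N, w i = 
        ∑ i ∈ (Finset.range N).filter (fun i => Y.Rq hlt i.unpair.1 i.unpair.2), Y.wt i.unpair.1 := by
      rw [Finset.sum_filter]
    rw [e]
    unfold Sys0.wts
    rw [Finset.sum_sigma']
    have e2 : ∑ i ∈ (Finset.range N).filter (fun i => Y.Rq hlt i.unpair.1 i.unpair.2), Y.wt i.unpair.1 =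
      ∑ z ∈ ((Finset.range N).filter (fun i => Y.Rq hlt i.unpair.1 i.unpair.2)).image 
        (fun i => (⟨i.unpair.2, i.unpair.1⟩ : (_ : ℕ) × ℕ)), Y.wt z.2 := by
      rw [Finset.sum_image]
      intro a _ b _ hab
      simp only [Sigma.mk.injEq, heq_eq_eq] at hab
      rw [← Nat.pair_unpair a, ← Nat.pair_unpair b, hab.1, hab.2]
    rw [e2]
    apply Finset.sum_le_sum_of_subset_of_nonneg
    · intro z hz
      obtain ⟨i, hi, rfl⟩ := Finset.mem_image.1 hz
      rw [Finset.mem_filter, Finset.mem_range] at hi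
      rw [Finset.mem_sigma, Finset.mem_range]
      refine ⟨(Nat.unpair_right_le i).trans_lt hi.1, ?_⟩
      unfold Sys.rqs
      rw [Finset.mem_filter, Finset.mem_range]
      exact ⟨Y.al_lt _ _ hi.2.1, hi.2⟩
    · intro z _ _; exact Y.wt_nonneg _
  obtain ⟨I, hI⟩ := tail_small w hw0 4 hw4 ((1/2)^(l+1)) (by positivity)
  set n0 := (Finset.range I).sup (fun i => Y.nn i.unpair.1) + 1 with hn0
  have hbig : ∀ i, n0 ≤ Y.nn i.unpair.1 → I ≤ i := by
    intro i hi
    by_contra h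
    have : Y.nn i.unpair.1 ≤ (Finset.range I).sup (fun i => Y.nn i.unpair.1) :=
      Finset.le_sup (f := fun i => Y.nn i.unpair.1) (Finset.mem_range.2 (not_le.1 h))
    omega
  have hlenp : ∀ i : ℕ, Y.Rq hlt i.unpair.1 i.unpair.2 → n0 ≤ Y.nn i.unpair.1 → l + 1 ≤ len i.unpair.1 := by
    intro i h1 h2
    have h3 := hI {i} (by simpa using hbig i h2)
    rw [Finset.sum_singleton] at h3
    simp only [hw] at h3
    rw [if_pos h1] at h3
    have h4 : Y.wt i.unpair.1 = (1/2)^len i.unpair.1 := rfl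
    rw [h4] at h3
    by_contra hcon
    have : ((1:ℝ)/2)^(l+1) < (1/2)^len i.unpair.1 :=
      pow_lt_pow_right_of_lt_one₀ (by norm_num) (by norm_num) (not_le.1 hcon)
    linarith
  set f : Reqs := rqF Y cA cU n0 l with hf
  have hsum : ∀ N, ∑ j ∈ Finset.range N, rwt f j ≤ 1/2 := by
    intro N
    have h1 : ∀ j ∈ Finset.range N, rwt f j ≤ if rqB Y cA cU n0 j.unpair.1 j.unpair.2 = true then 2^l * w j else 0 := by
      intro j _
      simp only [rwt, hf, rqF]
      rcases hr : rqB Y cA cU n0 j.unpair.1 j.unpair.2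
      · simp
      · have h2 := rqB_iff.1 hr
        have h3 := hlenp j h2.1 h2.2
        simp only [cond_true, if_true, hw]
        rw [if_pos h2.1]
        have h4 : Y.wt j.unpair.1 = (1/2)^len j.unpair.1 := rfl
        rw [h4]
        obtain ⟨r, hr⟩ := Nat.exists_eq_add_of_le (show l ≤ len j.unpair.1 by omega)
        rw [hr, Nat.add_sub_cancel_left, pow_add, ← mul_assoc, ← mul_pow]
        norm_num
    refine (Finset.sum_le_sum h1).trans ?_
    rw [← Finset.sum_filter, ← Finset.mul_sum]
    have h5 := hI ((Finset.range N).filter fun j => rqB Y cA cU n0 j.unpair.1 j.unpair.2 = true) (by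
      intro i hi
      exact hbig i (rqB_iff.1 (Finset.mem_filter.1 hi).2).2)
    have h6 := mul_le_mul_of_nonneg_left h5 (show (0:ℝ) ≤ 2^l by positivity)
    refine h6.trans (le_of_eq ?_)
    rw [pow_succ, ← mul_assoc, ← mul_pow]
    norm_num
  obtain ⟨M, hM, hM1, hM2⟩ := glue hU.1 A ρ (restrSet B) n0 hρ1 q0 _ hq0 hσ f 
    (rqF_primrec Y cA cU n0 l (Y.br_primrec hlt hch hnl hlt_primrec)).to_comp hsum
  refine ⟨M, hM, fun n => ?_⟩
  rw [hρ2 n]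
  by_cases hn : n < n0
  · exact KC_le (hM1 n hn)
  · set p := Encodable.encode (ρ n) with hp
    obtain ⟨s1, hs1⟩ := uu_complete hc (hρ1 n)
    rw [← hp] at hs1
    obtain ⟨s2, hs2⟩ := ch_fin_aux cA n
    obtain ⟨s3, hs3⟩ := br_lim Y B hB n
    have hinf : (uuInf cU p).length = n := by rw [uuInf_eq hs1, restrSet_length]
    have hex : ∃ s, cal cA cU p s = true ∧ Y.br hlt s n = restrSet B n := by
      refine ⟨s1 + s2 + s3 + 1, ?_, hs3 _ (by omega)⟩
      rw [cal_iff, hinf, uu_mono (by omega) hs1]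
      have := rs_final hcA (t := s1 + s2 + s3) (d := n) (m := n)
        (rs_const fun t' ht' => hs2 t' (by omega)) le_rfl
      rw [this]
    obtain ⟨hx1, hx2⟩ := Nat.find_spec hex
    have hmin := fun m => Nat.find_min hex (m := m)
    rcases hs : Nat.find hex with _ | s
    · rw [hs] at hx1
      have := Y.al_lt p 0 hx1
      omega
    · rw [hs] at hx1 hx2 hmin
      have hm := hmin s (by omega)
      have hnn : Y.nn p = n := hinf
      have hRq : Y.Rq hlt p s := by
        refine ⟨hx1, ?_⟩
        by_cases ha : Y.al p s = true
        · right
          rw [hnn, hx2]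
          intro hcon
          exact hm ⟨ha, hcon.symm⟩
        · left; simpa using ha
      have hrB : rqB Y cA cU n0 p s = true := rqB_iff.2 ⟨hRq, by rw [← hY, hnn]; omega⟩
      have hfi : f (Nat.pair p s) = Option.some (len p - l, restrSet B n) := by
        simp only [hf, rqF, Nat.unpair_pair, hrB, cond_true]
        rw [nnS_eq (cal_iff.1 hx1), hinf, hx2]
      obtain ⟨ρ', h1, h2⟩ := hM2 _ _ hfi
      have h3 := KC_le h2
      have h4 : l + 1 ≤ len p := by
        have := hlenp (Nat.pair p s)
        rw [Nat.unpair_pair] at this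
        exact this hRq (by rw [hnn]; omega)
      have h5 : len p = (ρ n).length := len_encode _
      simp only at h1 h3
      have h6 : ρ'.length = (ρ n).length := by omega
      rw [h6] at h3
      exact h3

end Concrete

/-- For every c.e. set `A` that is not `K`-trivial there are a c.e. set
`B` and a (computably enumerable) prefix-free machine `M` with `B ≡_T ∅'` and
`K_M(B↾n) ≤ K(A↾n)` for all `n`. -/
theorem stmt15 (U : Str →. Str) (hU : OptimalPF U)
    (A : Set ℕ) (hA : CESet A) (hAnt : ¬ KTrivialSet U A) :
    ∃ (B : Set ℕ) (M : Str →. Str), CESet B ∧ PFMachine M ∧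
      TuringEquivSet B haltingSet ∧
      ∀ n, KC M (restrSet B n) ≤ KC U (restrSet A n) := by
  obtain ⟨fA, hfA, hA2⟩ := hA
  obtain ⟨cA, hcA⟩ := Nat.Partrec.Code.exists_code.1 hfA
  obtain ⟨cU, hcU⟩ := Nat.Partrec.Code.exists_code.1 hU.1.1
  have hcA' : ∀ n, n ∈ A ↔ (Nat.Partrec.Code.eval cA n).Dom := by rw [hcA]; exact hA2
  have hc : Computes cU U := hcU
  set Y := mkSys cA cU U hU.1 hc with hY
  have hch : Primrec₂ Y.ch := mk_ch _ _ _ _ _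
  have hnl : Y.NLP := mk_nl _ _ _ _ _
  obtain ⟨fB, hfB, hfB2⟩ := bool_ce (Y.Bs hlt) (Y.Bs_primrec hlt hch hnl hlt_primrec)
  let B : Set ℕ := {n | ∃ s, Y.Bs hlt s n = true}
  have hB : ∀ n, n ∈ B ↔ ∃ s, Y.Bs hlt s n = true := fun n => Iff.rfl
  have hB2 : ∀ n, n ∈ B ↔ (fB n).Dom := hfB2
  obtain ⟨M, hM, hM2⟩ := main_machine hU hcA' hc hB
  exact ⟨B, M, ⟨fB, hfB, hB2⟩, hM, ⟨ce_le_halting hfB hB2, 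
    halting_le B hB (pos_conv hU hcA' hc hAnt)⟩, hM2⟩

end KPaper
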